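/- Let SC_m be the m-dimensional Sierpinski carpet graph (pre-Sierpinski carpet) with m ≥ 3, and let (E_n) be the external DLA process on SC_m started from E_0 = {o}. Let r(E_n) be the radius of E_n from o. Then almost surely limsup_{n→∞} n^{−β} r(E_n) < ∞, where β = (log_2(13) − 2)/3 = 0.5568… if m = 3 and β = 1/2 if m = 4; and for m ≥ 5, almost surely limsup_{n→∞} (log n)^{−1} n^{−2/(d(m)−2)} r(E_n) < ∞, where d(m) = log(3^m − 1) / (log(3^m − 1) − log(3^{m−1} − 1)). -/

import Mathlib

open MeasureTheory Filter Topology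

open Classical in
/-- Probability that the random walk which at each step moves uniformly to one of the
points in `nbr ·`, started at `x`, hits the set `A` within `n` steps, with first
hitting position `y`. -/
noncomputable def hitP {V : Type*} (nbr : V → Finset V) (A : Set V) : ℕ → V → V → ℝ
  | 0, x, y => if x ∈ A ∧ x = y then 1 else 0
  | n+1, x, y =>
      if x ∈ A then (if x = y then 1 else 0)
      else ((nbr x).card : ℝ)⁻¹ * ∑ z ∈ nbr x, hitP nbr A n z y

/-- The hitting distribution `H_A(x,y)`. -/
noncomputable def hitMeas {V : Type*} (nbr : V → Finset V) (A : Set V) (x y : V) : ℝ :=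
  ⨆ n, hitP nbr A n x y

/-- Outer boundary of a finite set. -/
noncomputable def bdryF {V : Type*} [DecidableEq V] (nbr : V → Finset V) (A : Finset V) :
    Finset V :=
  A.biUnion nbr \ A

/-- The lattice neighbors of a point of `ℤ^m`. -/
noncomputable def latNbrs {m : ℕ} (x : Fin m → ℤ) : Finset (Fin m → ℤ) :=
  (Finset.univ ×ˢ ({1, -1} : Finset ℤ)).image (fun p => Function.update x p.1 (x p.1 + p.2))

/-- A lattice point belongs to the `m`-dimensional pre-Sierpinski carpet iff all its
coordinates are nonnegative and at no scale do all of its ternary digits equal `1`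
(i.e. it avoids all the removed central cubes). -/
def inCarpet (m : ℕ) (x : Fin m → ℤ) : Prop :=
  (∀ i, 0 ≤ x i) ∧ ∀ k : ℕ, ¬ ∀ i, (x i / 3 ^ k) % 3 = 1

/-- The vertex set of the `m`-dimensional Sierpinski carpet graph. -/
def CarpetV (m : ℕ) := {x : Fin m → ℤ // inCarpet m x}

noncomputable instance {m : ℕ} : DecidableEq (CarpetV m) := Classical.decEq _

open Classical in
/-- Neighbors in the carpet graph: lattice neighbors that belong to the carpet. -/
noncomputable def cNbrs {m : ℕ} (x : CarpetV m) : Finset (CarpetV m) :=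
  (latNbrs x.1).subtype (inCarpet m)

/-- Graph-metric balls of the carpet graph, centered at `o`. -/
def cBall {m : ℕ} (o : CarpetV m) : ℕ → Set (CarpetV m)
  | 0 => {o}
  | n+1 => cBall o n ∪ {y | ∃ x ∈ cBall o n, (∑ i, |x.1 i - y.1 i|) = 1}

/-- Graph distance from `o` in the carpet graph. -/
noncomputable def cDist {m : ℕ} (o x : CarpetV m) : ℕ := sInf {n : ℕ | x ∈ cBall o n}

/-- Radius of a cluster in the graph metric: `r(A) = max {d(o,x) : x ∈ A}`. -/
noncomputable def radC {m : ℕ} (o : CarpetV m) (A : Finset (CarpetV m)) : ℝ :=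
  ⨆ x ∈ A, (cDist o x : ℝ)

/-! ### Arithmetic of the carpet -/

/-- The ternary digit vectors. -/
noncomputable def trits (m : ℕ) : Finset (Fin m → ℤ) := Fintype.piFinset fun _ => Finset.Icc 0 2

/-- The index of the `q`-th child block of the block `z`. -/
def child {m : ℕ} (z q : Fin m → ℤ) : Fin m → ℤ := fun i => 3 * z i + q i

/-- The index of the block of side `3 ^ k` containing `x`. -/
def blockIdx {m : ℕ} (k : ℕ) (x : Fin m → ℤ) : Fin m → ℤ := fun i => x i / 3 ^ k

lemma mem_trits {m : ℕ} {q : Fin m → ℤ} : q ∈ trits m ↔ ∀ i, 0 ≤ q i ∧ q i ≤ 2 := by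
  simp [trits]

lemma card_trits (m : ℕ) : (trits m).card = 3 ^ m := by
  simp [trits]

lemma child_injective {m : ℕ} (z : Fin m → ℤ) : Function.Injective (child z) := by
  intro q q' h
  ext i
  have := congrFun h i
  simp only [child] at this
  omega

lemma inCarpet_child {m : ℕ} {z q : Fin m → ℤ} (hz : inCarpet m z) (hq : q ∈ trits m)
    (h1 : ∃ i, q i ≠ 1) : inCarpet m (child z q) := by
  rw [mem_trits] at hq
  refine ⟨fun i => ?_, fun k => ?_⟩
  · have := hz.1 i
    have := hq i
    simp only [child]
    omega
  · cases k with
    | zero =>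
      intro h
      obtain ⟨i, hi⟩ := h1
      have := h i
      have := hq i
      simp only [child, pow_zero, Int.ediv_one] at *
      omega
    | succ k =>
      intro h
      refine hz.2 k fun i => ?_
      have h' := h i
      have h3 : child z q i / 3 ^ (k + 1) = z i / 3 ^ k := by
        rw [pow_succ', ← Int.ediv_ediv_of_nonneg (by norm_num)]
        congr 1
        have := hq i
        simp only [child]
        omega
      rwa [h3] at h'

lemma blockIdx_zero {m : ℕ} (x : Fin m → ℤ) : blockIdx 0 x = x := by
  ext i; simp [blockIdx]

lemma blockIdx_succ {m : ℕ} (k : ℕ) (x : Fin m → ℤ) (i : Fin m) :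
    blockIdx (k + 1) x i = blockIdx k x i / 3 := by
  simp only [blockIdx]
  rw [pow_succ, ← Int.ediv_ediv_of_nonneg (by positivity)]

lemma inCarpet_blockIdx {m : ℕ} {x : Fin m → ℤ} (hx : inCarpet m x) (k : ℕ) :
    inCarpet m (blockIdx k x) := by
  refine ⟨fun i => Int.ediv_nonneg (hx.1 i) (by positivity), fun j h => hx.2 (k + j) fun i => ?_⟩
  have := h i
  simp only [blockIdx] at this
  rwa [pow_add, ← Int.ediv_ediv_of_nonneg (by positivity)]

lemma blockIdx_eq_child {m : ℕ} (k : ℕ) (x : Fin m → ℤ) :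
    ∃ q ∈ trits m, blockIdx k x = child (blockIdx (k + 1) x) q := by
  refine ⟨fun i => blockIdx k x i % 3, ?_, ?_⟩
  · rw [mem_trits]
    intro i
    omega
  · ext i
    simp only [child, blockIdx_succ]
    omega

lemma exists_ne_one_of_inCarpet_child {m : ℕ} {z q : Fin m → ℤ} (h : inCarpet m (child z q)) :
    ∃ i, q i ≠ 1 := by
  by_contra! hq
  refine h.2 0 fun i => ?_
  simp only [child, hq, pow_zero, Int.ediv_one]
  omega

lemma digit_eq_zero {x : ℤ} {k l : ℕ} (h : (3 : ℤ) ^ k ∣ x) (hl : l < k) : x / 3 ^ l % 3 = 0 := by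
  obtain ⟨c, rfl⟩ := h
  obtain ⟨d, rfl⟩ := Nat.exists_eq_add_of_lt hl
  have : (3 : ℤ) ^ (l + d + 1) * c = 3 ^ l * (3 * (3 ^ d * c)) := by ring
  rw [this, Int.mul_ediv_cancel_left _ (by positivity)]
  simp

lemma digit_of_pred {x : ℤ} {k : ℕ} (h1 : (x - 1) / 3 ^ k % 3 = 1) (h2 : x / 3 ^ k % 3 ≠ 1) :
    (3 : ℤ) ^ k ∣ x ∧ x / 3 ^ k % 3 = 2 := by
  have hp : (0 : ℤ) < 3 ^ k := by positivity
  generalize (3 : ℤ) ^ k = p at *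
  have hd := Int.emod_add_mul_ediv x p
  have h0 := Int.emod_nonneg x hp.ne'
  have hlt := Int.emod_lt_of_pos x hp
  rcases h0.eq_or_lt with h | h
  · have hx : x = p * (x / p) := by linarith
    have h3 : (x - 1) / p = x / p - 1 := by
      rw [Int.ediv_eq_iff_of_pos hp]
      constructor <;> nlinarith
    refine ⟨Int.dvd_of_emod_eq_zero h.symm, ?_⟩
    omega
  · exfalso
    have h3 : (x - 1) / p = x / p := by
      rw [Int.ediv_eq_iff_of_pos hp]
      constructor <;> nlinarith
    rw [h3] at h1
    exact h2 h1

/-- Every nonzero point of the carpet has a neighbor in the carpet closer to the origin. -/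
lemma exists_pred {m : ℕ} (hm : 2 ≤ m) {x : Fin m → ℤ} (hx : inCarpet m x) (h0 : x ≠ 0) :
    ∃ j, 0 < x j ∧ inCarpet m (x - Pi.single j 1) := by
  by_contra! hcon
  have key : ∀ j, 0 < x j → ∃ k : ℕ, (3 : ℤ) ^ k ∣ x j ∧ x j / 3 ^ k % 3 = 2 ∧
      ∀ i, i ≠ j → x i / 3 ^ k % 3 = 1 := by
    intro j hj
    have hn := hcon j hj
    have hk : ∃ k : ℕ, ∀ i, ((x - Pi.single j 1 : Fin m → ℤ) i / 3 ^ k) % 3 = 1 := by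
      by_contra! hk
      refine hn ⟨fun i => ?_, fun k h => ?_⟩
      · have := hx.1 i
        by_cases hij : i = j
        · subst hij; simp; omega
        · simp [hij, this]
      · obtain ⟨i, hi⟩ := hk k
        exact hi (h i)
    obtain ⟨k, hk⟩ := hk
    have ho : ∀ i, i ≠ j → x i / 3 ^ k % 3 = 1 := by
      intro i hi
      simpa [hi] using hk i
    have h1 : (x j - 1) / 3 ^ k % 3 = 1 := by simpa using hk j
    have h2 : x j / 3 ^ k % 3 ≠ 1 := by
      intro h
      refine hx.2 k fun i => ?_
      by_cases hij : i = j
      · subst hij; exact h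
      · exact ho i hij
    obtain ⟨h3, h4⟩ := digit_of_pred h1 h2
    exact ⟨k, h3, h4, ho⟩
  obtain ⟨j, hj⟩ : ∃ j, x j ≠ 0 := by
    by_contra! h
    exact h0 (funext h)
  have hj : 0 < x j := lt_of_le_of_ne (hx.1 j) (Ne.symm hj)
  obtain ⟨k, hk1, hk2, hk3⟩ := key j hj
  have : Nontrivial (Fin m) := Fin.nontrivial_iff_two_le.2 hm
  obtain ⟨i, hi⟩ := exists_ne j
  have hik := hk3 i hi
  have hi0 : 0 < x i := by
    refine lt_of_le_of_ne (hx.1 i) fun h => ?_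
    rw [← h] at hik
    simp at hik
  obtain ⟨l, hl1, hl2, hl3⟩ := key i hi0
  have hjl := hl3 j hi.symm
  rcases lt_trichotomy l k with h | h | h
  · have := digit_eq_zero hk1 h
    omega
  · subst h; omega
  · have := digit_eq_zero hl1 h
    omega

/-! ### Column averages over blocks -/

/-- The child blocks lying on full columns in direction `i`. -/
noncomputable def colSet {m : ℕ} (i : Fin m) : Finset (Fin m → ℤ) :=
  (trits m).filter fun q => ∃ j, j ≠ i ∧ q j ≠ 1

/-- The child blocks at the bottom of the full columns in direction `i`. -/
noncomputable def colBase {m : ℕ} (i : Fin m) : Finset (Fin m → ℤ) :=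
  (trits m).filter fun q => q i = 0 ∧ ∃ j, j ≠ i ∧ q j ≠ 1

lemma colSet_subset {m : ℕ} (i : Fin m) : colSet i ⊆ trits m := Finset.filter_subset _ _

lemma exists_ne_one_of_mem_colSet {m : ℕ} {i : Fin m} {q : Fin m → ℤ} (h : q ∈ colSet i) :
    ∃ j, q j ≠ 1 := by
  simp only [colSet, Finset.mem_filter] at h
  obtain ⟨-, j, -, hj⟩ := h
  exact ⟨j, hj⟩

lemma add_single_mem_colSet {m : ℕ} {i : Fin m} {y : Fin m → ℤ} (hy : y ∈ colBase i) {s : ℤ}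
    (hs0 : 0 ≤ s) (hs : s ≤ 2) : y + Pi.single i s ∈ colSet i := by
  simp only [colBase, colSet, Finset.mem_filter, mem_trits] at hy ⊢
  obtain ⟨h1, h2, j, hj, hj1⟩ := hy
  refine ⟨fun l => ?_, j, hj, by simpa [hj] using hj1⟩
  by_cases hl : l = i
  · subst hl; simp [h2, hs0, hs]
  · simpa [hl] using h1 l

lemma sum_colSet {m : ℕ} (i : Fin m) (φ : (Fin m → ℤ) → ℝ) :
    ∑ q ∈ colSet i, φ q = ∑ y ∈ colBase i, ∑ s ∈ Finset.range 3, φ (y + Pi.single i (s : ℤ)) := by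
  rw [← Finset.sum_product']
  symm
  refine Finset.sum_bij' (fun p _ => p.1 + Pi.single i (p.2 : ℤ))
    (fun q _ => (q - Pi.single i (q i), (q i).toNat)) ?_ ?_ ?_ ?_ ?_
  · rintro ⟨y, s⟩ h
    simp only [Finset.mem_product, Finset.mem_range] at h
    exact add_single_mem_colSet h.1 (by omega) (by omega)
  · intro q hq
    simp only [colBase, colSet, Finset.mem_product, Finset.mem_range, Finset.mem_filter,
      mem_trits] at hq ⊢
    obtain ⟨h1, j, hj, hj1⟩ := hq
    refine ⟨⟨fun l => ?_, by simp, j, hj, by simpa [hj] using hj1⟩, ?_⟩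
    · by_cases hl : l = i
      · subst hl; simp
      · simpa [hl] using h1 l
    · have := h1 i
      omega
  · rintro ⟨y, s⟩ h
    simp only [colBase, Finset.mem_product, Finset.mem_filter] at h
    simp [h.1.2.1]
  · intro q hq
    simp only [colSet, Finset.mem_filter, mem_trits] at hq
    have := hq.1 i
    simp only
    rw [Int.toNat_of_nonneg this.1]
    simp
  · intros; rfl

lemma sum_trits {m : ℕ} (i : Fin m) (φ : (Fin m → ℤ) → ℝ) :
    ∑ q ∈ trits m, φ q = ∑ q ∈ colSet i, φ q +
      (φ 1 + φ (1 + Pi.single i 1) + φ (1 - Pi.single i 1)) := by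
  rw [colSet, ← Finset.sum_filter_add_sum_filter_not (trits m) (fun q => ∃ j, j ≠ i ∧ q j ≠ 1)]
  congr 1
  have hset : (trits m).filter (fun q => ¬ ∃ j, j ≠ i ∧ q j ≠ 1)
      = {1, 1 + Pi.single i 1, 1 - Pi.single i 1} := by
    ext q
    simp only [Finset.mem_filter, mem_trits, Finset.mem_insert, Finset.mem_singleton]
    constructor
    · rintro ⟨h1, h2⟩
      push Not at h2
      have hq : ∀ c, q i = 1 + c → q = 1 + Pi.single i c := by
        intro c hc
        ext j
        by_cases hj : j = i
        · subst hj; simp [hc]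
        · simp [hj, h2 j hj]
      have := h1 i
      have h3 : q i = 0 ∨ q i = 1 ∨ q i = 2 := by omega
      rcases h3 with h | h | h
      · right; right
        rw [hq (-1) (by omega), Pi.single_neg, sub_eq_add_neg]
      · left
        rw [hq 0 (by omega)]; simp
      · right; left
        exact hq 1 (by omega)
    · have aux : ∀ c : ℤ, -1 ≤ c → c ≤ 1 → (∀ l, 0 ≤ (1 + Pi.single i c : Fin m → ℤ) l ∧
          (1 + Pi.single i c : Fin m → ℤ) l ≤ 2) ∧
          ¬ ∃ j, j ≠ i ∧ (1 + Pi.single i c : Fin m → ℤ) j ≠ 1 := by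
        intro c h1 h2
        refine ⟨fun l => ?_, ?_⟩
        · by_cases hl : l = i
          · subst hl; simp; omega
          · simp [hl]
        · push Not
          intro j hj
          simp [hj]
      rintro (h | h | h)
      · have := aux 0 (by norm_num) (by norm_num)
        rw [Pi.single_zero, add_zero] at this
        rw [h]; exact this
      · rw [h]; exact aux 1 (by norm_num) (by norm_num)
      · have := aux (-1) (by norm_num) (by norm_num)
        rw [Pi.single_neg, ← sub_eq_add_neg] at this
        rw [h]; exact this
  rw [hset, Finset.sum_insert, Finset.sum_insert, Finset.sum_singleton, add_assoc]
  · intro h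
    have := congrFun (Finset.mem_singleton.1 h) i
    simp at this
  · intro h
    rcases Finset.mem_insert.1 h with h | h
    · have := congrFun h i
      simp at this
    · have := congrFun (Finset.mem_singleton.1 h) i
      simp at this

lemma card_colSet {m : ℕ} (i : Fin m) : ((colSet i).card : ℝ) = 3 ^ m - 3 := by
  have h := sum_trits i (fun _ => (1 : ℝ))
  simp only [Finset.sum_const, nsmul_eq_mul, mul_one, card_trits] at h
  push_cast at h
  linarith

/-- The average of `f` over the full columns in direction `i` of the block `z` at level `k`. -/
noncomputable def colAvg {m : ℕ} (f : (Fin m → ℤ) → ℝ) (i : Fin m) : ℕ → (Fin m → ℤ) → ℝ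
  | 0, z => f z
  | k + 1, z => (∑ q ∈ colSet i, colAvg f i k (child z q)) / (3 ^ m - 3)

/-- The average of `f` over the endpoints of the full columns in direction `i` of a block. -/
noncomputable def faceAvg {m : ℕ} (f : (Fin m → ℤ) → ℝ) (i : Fin m) : ℕ → (Fin m → ℤ) → ℝ
  | 0, z => f z
  | k + 1, z => (∑ y ∈ colBase i, faceAvg f i k (child z y)) / ((3 ^ m - 3) / 3)

/-- The averaged total variation along the full columns in direction `i` of a block,
given the variation `g` at level zero. -/
noncomputable def colVar {m : ℕ} (g : (Fin m → ℤ) → ℝ) (i : Fin m) : ℕ → (Fin m → ℤ) → ℝ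
  | 0, z => g z
  | k + 1, z => (∑ q ∈ colSet i, colVar g i k (child z q)) / ((3 ^ m - 3) / 3)

lemma colVar_nonneg {m : ℕ} (hm : 1 ≤ m) {g : (Fin m → ℤ) → ℝ} (hg : ∀ z, 0 ≤ g z) (i : Fin m)
    (k : ℕ) (z : Fin m → ℤ) : 0 ≤ colVar g i k z := by
  have h3 : (3 : ℝ) ≤ 3 ^ m := by
    simpa using pow_le_pow_right₀ (by norm_num : (1 : ℝ) ≤ 3) hm
  induction k generalizing z with
  | zero => exact hg z
  | succ k ih =>
    exact div_nonneg (Finset.sum_nonneg fun q _ => ih _) (by linarith)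

lemma child_add_single {m : ℕ} (z y : Fin m → ℤ) (i : Fin m) :
    child (z + Pi.single i 1) y = child z (y + Pi.single i 3) := by
  ext j
  by_cases hj : j = i
  · subst hj; simp [child]; ring
  · simp [child, hj]

lemma child_add_single' {m : ℕ} (z y : Fin m → ℤ) (i : Fin m) (s : ℤ) :
    child z (y + Pi.single i s) = child z y + Pi.single i s := by
  ext j
  simp only [child, Pi.add_apply]; ring

section
variable {m : ℕ} {f g : (Fin m → ℤ) → ℝ}

lemma inCarpet_child_colSet {z q : Fin m → ℤ} {i : Fin m} (hz : inCarpet m z) (hq : q ∈ colSet i) :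
    inCarpet m (child z q) :=
  inCarpet_child hz (colSet_subset i hq) (exists_ne_one_of_mem_colSet hq)

lemma inCarpet_child_colBase {z y : Fin m → ℤ} {i : Fin m} (hz : inCarpet m z)
    (hy : y ∈ colBase i) {s : ℤ} (h0 : 0 ≤ s) (h2 : s ≤ 2) :
    inCarpet m (child z y + Pi.single i s) := by
  rw [← child_add_single']
  exact inCarpet_child_colSet hz (add_single_mem_colSet hy h0 h2)

lemma abs_faceAvg_step (hm : 2 ≤ m)
    (hf : ∀ z i, inCarpet m z → inCarpet m (z + Pi.single i 1) →
      |f (z + Pi.single i 1) - f z| ≤ g z)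
    (i : Fin m) (k : ℕ) : ∀ z, inCarpet m z → inCarpet m (z + Pi.single i 1) →
      |faceAvg f i k (z + Pi.single i 1) - faceAvg f i k z| ≤ colVar g i k z := by
  have h9 : (9 : ℝ) ≤ 3 ^ m := by
    have := pow_le_pow_right₀ (by norm_num : (1 : ℝ) ≤ 3) hm
    norm_num at this; exact this
  induction k with
  | zero => intro z hz hz'; exact hf z i hz hz'
  | succ k ih =>
    intro z hz hz'
    simp only [faceAvg, colVar]
    rw [← sub_div, abs_div, abs_of_pos (by linarith : (0 : ℝ) < (3 ^ m - 3) / 3)]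
    gcongr
    · linarith
    rw [sum_colSet, ← Finset.sum_sub_distrib]
    refine (Finset.abs_sum_le_sum_abs _ _).trans (Finset.sum_le_sum fun y hy => ?_)
    have a0 := inCarpet_child_colBase hz hy (s := 0) (by norm_num) (by norm_num)
    have a1 := inCarpet_child_colBase hz hy (s := 1) (by norm_num) (by norm_num)
    have a2 := inCarpet_child_colBase hz hy (s := 2) (by norm_num) (by norm_num)
    have a3 := inCarpet_child_colBase hz' hy (s := 0) (by norm_num) (by norm_num)
    have e2 : child z y + Pi.single i 1 + Pi.single i 1 = child z y + Pi.single i 2 := by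
      rw [add_assoc, ← Pi.single_add]; norm_num
    have e3 : child z y + Pi.single i 2 + Pi.single i 1 = child (z + Pi.single i 1) y := by
      rw [add_assoc, ← Pi.single_add, child_add_single, child_add_single']; norm_num
    simp only [Pi.single_zero, add_zero] at a0 a3
    have b0 := ih _ a0 a1
    have b1 := ih _ a1 (by rw [e2]; exact a2)
    have b2 := ih _ a2 (by rw [e3]; exact a3)
    rw [e2] at b1
    rw [e3] at b2
    simp only [Finset.sum_range_succ, Finset.sum_range_zero, Nat.cast_zero, Nat.cast_one,
      Nat.cast_ofNat, Pi.single_zero, add_zero, zero_add, child_add_single']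
    rw [abs_le] at *
    constructor <;> linarith

lemma abs_colAvg_sub_faceAvg (hm : 2 ≤ m) (hg : ∀ z, 0 ≤ g z)
    (hf : ∀ z i, inCarpet m z → inCarpet m (z + Pi.single i 1) →
      |f (z + Pi.single i 1) - f z| ≤ g z)
    (i : Fin m) (k : ℕ) : ∀ z, inCarpet m z →
      |colAvg f i k z - faceAvg f i k z| ≤ colVar g i k z := by
  have h9 : (9 : ℝ) ≤ 3 ^ m := by
    have := pow_le_pow_right₀ (by norm_num : (1 : ℝ) ≤ 3) hm
    norm_num at this; exact this
  induction k with
  | zero => intro z _; simpa [colAvg, faceAvg, colVar] using hg z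
  | succ k ih =>
    intro z hz
    simp only [colAvg, faceAvg, colVar]
    have e : ∀ a b : ℝ, a / (3 ^ m - 3) - b / ((3 ^ m - 3) / 3)
        = ((a - 3 * b) / 3) / ((3 ^ m - 3) / 3) := by
      intro a b
      have : (3 : ℝ) ^ m - 3 ≠ 0 := by linarith
      field_simp
    rw [e, abs_div, abs_of_pos (by linarith : (0 : ℝ) < (3 ^ m - 3) / 3)]
    gcongr
    · linarith
    rw [sum_colSet, sum_colSet, Finset.mul_sum, ← Finset.sum_sub_distrib, Finset.sum_div]
    refine (Finset.abs_sum_le_sum_abs _ _).trans (Finset.sum_le_sum fun y hy => ?_)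
    have a0 := inCarpet_child_colBase hz hy (s := 0) (by norm_num) (by norm_num)
    have a1 := inCarpet_child_colBase hz hy (s := 1) (by norm_num) (by norm_num)
    have a2 := inCarpet_child_colBase hz hy (s := 2) (by norm_num) (by norm_num)
    have e2 : child z y + Pi.single i 1 + Pi.single i 1 = child z y + Pi.single i 2 := by
      rw [add_assoc, ← Pi.single_add]; norm_num
    simp only [Pi.single_zero, add_zero] at a0
    have b0 := abs_faceAvg_step hm hf i k _ a0 a1
    have b1 := abs_faceAvg_step hm hf i k _ a1 (by rw [e2]; exact a2)
    rw [e2] at b1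
    have c0 := ih _ a0
    have c1 := ih _ a1
    have c2 := ih _ a2
    have n0 := colVar_nonneg (by omega) hg i k (child z y)
    have n1 := colVar_nonneg (by omega) hg i k (child z y + Pi.single i 1)
    have n2 := colVar_nonneg (by omega) hg i k (child z y + Pi.single i 2)
    simp only [Finset.sum_range_succ, Finset.sum_range_zero, Nat.cast_zero, Nat.cast_one,
      Nat.cast_ofNat, Pi.single_zero, add_zero, zero_add, child_add_single']
    rw [abs_le] at *
    constructor <;> linarith

lemma abs_colAvg_step (hm : 2 ≤ m) (hg : ∀ z, 0 ≤ g z)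
    (hf : ∀ z i, inCarpet m z → inCarpet m (z + Pi.single i 1) →
      |f (z + Pi.single i 1) - f z| ≤ g z)
    (i : Fin m) (k : ℕ) (z : Fin m → ℤ) (hz : inCarpet m z)
    (hz' : inCarpet m (z + Pi.single i 1)) :
    |colAvg f i k (z + Pi.single i 1) - colAvg f i k z|
      ≤ 2 * colVar g i k z + colVar g i k (z + Pi.single i 1) := by
  have h1 := abs_colAvg_sub_faceAvg hm hg hf i k z hz
  have h2 := abs_colAvg_sub_faceAvg hm hg hf i k _ hz'
  have h3 := abs_faceAvg_step hm hf i k z hz hz'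
  rw [abs_le] at *
  constructor <;> linarith

end

/-! ### Comparing averages on neighboring blocks through the energy -/

/-- Square root of the scaling factor of the resistance between neighboring blocks. -/
noncomputable def resRoot (m : ℕ) : ℝ := 3 / √(3 ^ m - 3)

section
variable {m : ℕ} {f : (Fin m → ℤ) → ℝ} {Eb : ℕ → (Fin m → ℤ) → ℝ}

lemma three_pow_ge (hm : 3 ≤ m) : (27 : ℝ) ≤ 3 ^ m := by
  have := pow_le_pow_right₀ (by norm_num : (1 : ℝ) ≤ 3) hm
  norm_num at this; exact this

lemma resRoot_pos (hm : 3 ≤ m) : 0 < resRoot m := by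
  have := three_pow_ge hm
  have : 0 < √((3 : ℝ) ^ m - 3) := Real.sqrt_pos.2 (by linarith)
  unfold resRoot
  positivity

lemma resRoot_sq (hm : 3 ≤ m) : resRoot m ^ 2 = 9 / (3 ^ m - 3) := by
  have := three_pow_ge hm
  rw [resRoot, div_pow, Real.sq_sqrt (by linarith)]
  norm_num

lemma resRoot_mul_sqrt (hm : 3 ≤ m) : resRoot m * √((3 : ℝ) ^ m - 3) = 3 := by
  have := three_pow_ge hm
  exact div_mul_cancel₀ _ (Real.sqrt_pos.2 (by linarith)).ne'

lemma sum_sqrt_le (s : Finset (Fin m → ℤ)) (a : (Fin m → ℤ) → ℝ) (ha : ∀ q, 0 ≤ a q) :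
    ∑ q ∈ s, √(a q) ≤ √(s.card) * √(∑ q ∈ s, a q) := by
  rw [← Real.sqrt_mul (by positivity)]
  apply Real.le_sqrt_of_sq_le
  have := sq_sum_le_card_mul_sum_sq (s := s) (f := fun q => √(a q))
  simpa [Real.sq_sqrt (ha _)] using this

lemma sum_child_le (hE0 : ∀ k z, 0 ≤ Eb k z)
    (hEs : ∀ k z, ∑ q ∈ trits m, Eb k (child z q) ≤ Eb (k + 1) z) {s : Finset (Fin m → ℤ)}
    (hs : s ⊆ trits m) (k : ℕ) (z : Fin m → ℤ) :
    ∑ q ∈ s, Eb k (child z q) ≤ Eb (k + 1) z :=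
  (Finset.sum_le_sum_of_subset_of_nonneg hs fun _ _ _ => hE0 _ _).trans (hEs k z)

lemma colVar_le (hm : 3 ≤ m) (hE0 : ∀ k z, 0 ≤ Eb k z)
    (hEs : ∀ k z, ∑ q ∈ trits m, Eb k (child z q) ≤ Eb (k + 1) z) (i : Fin m) (k : ℕ) :
    ∀ z, colVar (fun z => √(Eb 0 z)) i k z ≤ resRoot m ^ k * √(Eb k z) := by
  have h27 := three_pow_ge hm
  induction k with
  | zero => intro z; simp [colVar]
  | succ k ih =>
    intro z
    simp only [colVar]
    have hM : (0 : ℝ) < 3 ^ m - 3 := by linarith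
    have hs : 0 < √((3 : ℝ) ^ m - 3) := Real.sqrt_pos.2 hM
    have hss : √((3 : ℝ) ^ m - 3) * √((3 : ℝ) ^ m - 3) = 3 ^ m - 3 := Real.mul_self_sqrt hM.le
    have hr := resRoot_pos hm
    have hrs := resRoot_mul_sqrt hm
    rw [div_le_iff₀ (by linarith)]
    calc ∑ q ∈ colSet i, colVar (fun z => √(Eb 0 z)) i k (child z q)
        ≤ ∑ q ∈ colSet i, resRoot m ^ k * √(Eb k (child z q)) := Finset.sum_le_sum fun q _ => ih _
      _ = resRoot m ^ k * ∑ q ∈ colSet i, √(Eb k (child z q)) := by rw [Finset.mul_sum]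
      _ ≤ resRoot m ^ k * (√((3 : ℝ) ^ m - 3) * √(Eb (k + 1) z)) := by
          gcongr
          refine (sum_sqrt_le _ (fun q => Eb k (child z q)) fun q => hE0 _ _).trans ?_
          rw [card_colSet]
          gcongr
          exact sum_child_le hE0 hEs (colSet_subset i) k z
      _ = resRoot m ^ (k + 1) * √(Eb (k + 1) z) * ((3 ^ m - 3) / 3) := by
          linear_combination (resRoot m ^ k * √(Eb (k + 1) z) * resRoot m / 3) * hss
            - (resRoot m ^ k * √(Eb (k + 1) z) * √((3 : ℝ) ^ m - 3) / 3) * hrs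

variable (hm : 3 ≤ m) (hE0 : ∀ k z, 0 ≤ Eb k z)
    (hEs : ∀ k z, ∑ q ∈ trits m, Eb k (child z q) ≤ Eb (k + 1) z)
    (hf : ∀ z i, inCarpet m z → inCarpet m (z + Pi.single i 1) →
      |f (z + Pi.single i 1) - f z| ≤ √(Eb 0 z))
include hm hE0 hEs hf

lemma abs_colAvg_step_le {s : ℝ} (i : Fin m) (k : ℕ) (z : Fin m → ℤ) (hz : inCarpet m z)
    (hz' : inCarpet m (z + Pi.single i 1)) (h1 : √(Eb k z) ≤ s)
    (h2 : √(Eb k (z + Pi.single i 1)) ≤ s) :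
    |colAvg f i k (z + Pi.single i 1) - colAvg f i k z| ≤ 3 * resRoot m ^ k * s := by
  have h := abs_colAvg_step (by omega) (fun _ => Real.sqrt_nonneg _) hf i k z hz hz'
  have hr : 0 ≤ resRoot m ^ k := (pow_pos (resRoot_pos hm) k).le
  have a1 := (colVar_le hm hE0 hEs i k z).trans (mul_le_mul_of_nonneg_left h1 hr)
  have a2 := (colVar_le hm hE0 hEs i k (z + Pi.single i 1)).trans
    (mul_le_mul_of_nonneg_left h2 hr)
  linarith

lemma abs_colAvg_sub_colAvg (i j : Fin m) (k : ℕ) :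
    ∀ z, inCarpet m z → |colAvg f i k z - colAvg f j k z| ≤ 3 * resRoot m ^ k * √(Eb k z) := by
  have h27 := three_pow_ge hm
  induction k generalizing i j with
  | zero => intro z _; simp [colAvg]
  | succ k ih =>
    intro z hz
    by_cases hij : i = j
    · subst hij
      have := resRoot_pos hm
      simp only [sub_self, abs_zero]
      positivity
    set s := √(Eb (k + 1) z) with hs
    have hM : (0 : ℝ) < 3 ^ m - 3 := by linarith
    have hM4 : (4 : ℝ) ≤ √((3 : ℝ) ^ m - 3) := Real.le_sqrt_of_sq_le (by linarith)
    have hss : √((3 : ℝ) ^ m - 3) * √((3 : ℝ) ^ m - 3) = 3 ^ m - 3 := Real.mul_self_sqrt hM.le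
    have hr := resRoot_pos hm
    have hrs := resRoot_mul_sqrt hm
    have hrk : 0 < resRoot m ^ k := by positivity
    have hs0 : 0 ≤ s := Real.sqrt_nonneg _
    have hsub : ∀ q ∈ trits m, √(Eb k (child z q)) ≤ s := by
      intro q hq
      refine Real.sqrt_le_sqrt ?_
      simpa using sum_child_le hE0 hEs (Finset.singleton_subset_iff.2 hq) k z
    -- moving from `1 ± e_j` to `1 ± e_i` through `1 ± e_i ± e_j`
    have htr : ∀ a b : ℤ, -1 ≤ a → a ≤ 1 → -1 ≤ b → b ≤ 1 →
        (1 + Pi.single i a + Pi.single j b : Fin m → ℤ) ∈ trits m := by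
      intro a b h1 h2 h3 h4
      rw [mem_trits]
      intro l
      by_cases hl : l = i
      · subst hl
        simp [hij]; omega
      · by_cases hl' : l = j
        · subst hl'
          simp [hl]; omega
        · simp [hl, hl']
    have hcar : ∀ a b : ℤ, -1 ≤ a → a ≤ 1 → -1 ≤ b → b ≤ 1 → (a ≠ 0 ∨ b ≠ 0) →
        inCarpet m (child z (1 + Pi.single i a + Pi.single j b)) := by
      intro a b h1 h2 h3 h4 h5
      refine inCarpet_child hz (htr a b h1 h2 h3 h4) ?_
      rcases h5 with h | h
      · exact ⟨i, by simp [hij, h]⟩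
      · exact ⟨j, by simp [Ne.symm hij, h]⟩
    -- a unit step in direction `i`, and in direction `j`, for the averages
    have stepi : ∀ (i' : Fin m) (p q : Fin m → ℤ), p ∈ trits m → q ∈ trits m →
        q = p + Pi.single i' 1 → inCarpet m (child z p) → inCarpet m (child z q) →
        |colAvg f i' k (child z q) - colAvg f i' k (child z p)| ≤ 3 * resRoot m ^ k * s := by
      intro i' p q hp hq hpq hcp hcq
      subst hpq
      rw [child_add_single'] at hcq ⊢
      refine abs_colAvg_step_le hm hE0 hEs hf i' k _ hcp hcq (hsub p hp) ?_
      rw [← child_add_single']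
      exact hsub _ hq
    have hD : ∀ (i' j' : Fin m) (p : Fin m → ℤ), p ∈ trits m → inCarpet m (child z p) →
        |colAvg f i' k (child z p) - colAvg f j' k (child z p)| ≤ 3 * resRoot m ^ k * s := by
      intro i' j' p hp hcp
      refine (ih i' j' _ hcp).trans ?_
      gcongr
      exact hsub p hp
    have mv : ∀ c : ℤ, (c = 1 ∨ c = -1) →
        |colAvg f i k (child z (1 + Pi.single j c)) - colAvg f i k (child z (1 + Pi.single i c))|
          ≤ 12 * resRoot m ^ k * s := by
      intro c hc
      have c1 : -1 ≤ c := by omega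
      have c2 : c ≤ 1 := by omega
      have c3 : c ≠ 0 := by omega
      have tj := htr 0 c (by norm_num) (by norm_num) c1 c2
      have ti := htr c 0 c1 c2 (by norm_num) (by norm_num)
      have tij := htr c c c1 c2 c1 c2
      have kj := hcar 0 c (by norm_num) (by norm_num) c1 c2 (Or.inr c3)
      have ki := hcar c 0 c1 c2 (by norm_num) (by norm_num) (Or.inl c3)
      have kij := hcar c c c1 c2 c1 c2 (Or.inl c3)
      simp only [Pi.single_zero, add_zero] at tj ti kj ki
      have a1 : |colAvg f i k (child z (1 + Pi.single j c)) -
          colAvg f i k (child z (1 + Pi.single i c + Pi.single j c))| ≤ 3 * resRoot m ^ k * s := by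
        rcases hc with rfl | rfl
        · rw [abs_sub_comm]
          exact stepi i _ _ tj tij (by abel) kj kij
        · refine stepi i _ _ tij tj ?_ kij kj
          simp only [Pi.single_neg]; abel
      have a2 : |colAvg f j k (child z (1 + Pi.single i c + Pi.single j c)) -
          colAvg f j k (child z (1 + Pi.single i c))| ≤ 3 * resRoot m ^ k * s := by
        rcases hc with rfl | rfl
        · exact stepi j _ _ ti tij (by abel) ki kij
        · rw [abs_sub_comm]
          refine stepi j _ _ tij ti ?_ kij ki
          simp only [Pi.single_neg]; abel
      have a3 := hD i j _ tij kij
      have a4 := hD i j _ ti ki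
      rw [abs_le] at *
      constructor <;> linarith
    have m1 := mv 1 (Or.inl rfl)
    have m2 := mv (-1) (Or.inr rfl)
    simp only [Pi.single_neg, ← sub_eq_add_neg] at m2
    -- the change of averaging set
    have hset : |∑ q ∈ colSet i, colAvg f i k (child z q) -
        ∑ q ∈ colSet j, colAvg f i k (child z q)|
        ≤ 24 * resRoot m ^ k * s := by
      have e1 := sum_trits i (fun q => colAvg f i k (child z q))
      have e2 := sum_trits j (fun q => colAvg f i k (child z q))
      simp only at e1 e2
      rw [abs_le] at *
      constructor <;> linarith
    -- the change of direction inside each child block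
    have hdir : |∑ q ∈ colSet j, colAvg f i k (child z q) -
        ∑ q ∈ colSet j, colAvg f j k (child z q)|
        ≤ 3 * resRoot m ^ k * (√((3 : ℝ) ^ m - 3) * s) := by
      rw [← Finset.sum_sub_distrib]
      refine (Finset.abs_sum_le_sum_abs _ _).trans ?_
      calc ∑ q ∈ colSet j, |colAvg f i k (child z q) - colAvg f j k (child z q)|
          ≤ ∑ q ∈ colSet j, 3 * resRoot m ^ k * √(Eb k (child z q)) :=
            Finset.sum_le_sum fun q hq => ih i j _ (inCarpet_child_colSet hz hq)
        _ = 3 * resRoot m ^ k * ∑ q ∈ colSet j, √(Eb k (child z q)) := by rw [Finset.mul_sum]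
        _ ≤ _ := by
          gcongr
          refine (sum_sqrt_le _ (fun q => Eb k (child z q)) fun q => hE0 _ _).trans ?_
          rw [card_colSet]
          gcongr
          exact Real.sqrt_le_sqrt (sum_child_le hE0 hEs (colSet_subset j) k z)
    simp only [colAvg]
    rw [← sub_div, abs_div, abs_of_pos hM, div_le_iff₀ hM]
    have htot : |∑ q ∈ colSet i, colAvg f i k (child z q) -
        ∑ q ∈ colSet j, colAvg f j k (child z q)|
        ≤ (24 + 3 * √((3 : ℝ) ^ m - 3)) * (resRoot m ^ k * s) := by
      rw [abs_le] at *
      constructor <;> linarith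
    refine htot.trans ?_
    have e : 3 * resRoot m ^ (k + 1) * s * (3 ^ m - 3)
        = 9 * √((3 : ℝ) ^ m - 3) * (resRoot m ^ k * s) := by
      linear_combination (-3 * resRoot m ^ k * s * resRoot m) * hss
        + (3 * resRoot m ^ k * s * √((3 : ℝ) ^ m - 3)) * hrs
    rw [e]
    gcongr
    linarith

end

/-! ### Lower bound for the energy of functions equal to one on a given set -/

section
variable {m : ℕ} {f : (Fin m → ℤ) → ℝ} {Eb : ℕ → (Fin m → ℤ) → ℝ}

lemma child_zero (q : Fin m → ℤ) : child 0 q = q := by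
  ext i; simp [child]

lemma inCarpet_zero (hm : 1 ≤ m) : inCarpet m 0 :=
  ⟨fun _ => le_rfl, fun k h => by simpa using h ⟨0, hm⟩⟩

lemma colAvg_eq_zero (i : Fin m) (k : ℕ) :
    ∀ z, (∀ y, blockIdx k y = z → f y = 0) → colAvg f i k z = 0 := by
  induction k with
  | zero => intro z h; exact h z (blockIdx_zero z)
  | succ k ih =>
    intro z h
    simp only [colAvg]
    rw [Finset.sum_eq_zero, zero_div]
    intro q hq
    refine ih _ fun y hy => h y ?_
    ext j
    have hq := mem_trits.1 (colSet_subset i hq) j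
    rw [blockIdx_succ, hy]
    simp only [child]
    omega

section
variable (hm : 3 ≤ m) (hE0 : ∀ k z, 0 ≤ Eb k z)
    (hEs : ∀ k z, ∑ q ∈ trits m, Eb k (child z q) ≤ Eb (k + 1) z)
    (hf : ∀ z i, inCarpet m z → inCarpet m (z + Pi.single i 1) →
      |f (z + Pi.single i 1) - f z| ≤ √(Eb 0 z))
include hm hE0 hEs hf

lemma abs_colAvg_child_sub_zero (i : Fin m) (k : ℕ) (z : Fin m → ℤ) (hz : inCarpet m z) (n : ℕ) :
    ∀ q ∈ trits m, inCarpet m q → ∑ j, q j = n →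
      |colAvg f i k (child z q) - colAvg f i k (child z 0)|
        ≤ n * (9 * resRoot m ^ k * √(Eb (k + 1) z)) := by
  have hsub : ∀ q ∈ trits m, √(Eb k (child z q)) ≤ √(Eb (k + 1) z) := by
    intro q hq
    refine Real.sqrt_le_sqrt ?_
    simpa using sum_child_le hE0 hEs (Finset.singleton_subset_iff.2 hq) k z
  have hr := resRoot_pos hm
  have hcar : ∀ q ∈ trits m, inCarpet m q → inCarpet m (child z q) := by
    intro q hq hqc
    rw [← child_zero q] at hqc
    exact inCarpet_child hz hq (exists_ne_one_of_inCarpet_child hqc)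
  have hD : ∀ (i' j' : Fin m) (p : Fin m → ℤ), p ∈ trits m → inCarpet m p →
      |colAvg f i' k (child z p) - colAvg f j' k (child z p)|
        ≤ 3 * resRoot m ^ k * √(Eb (k + 1) z) := by
    intro i' j' p hp hcp
    refine (abs_colAvg_sub_colAvg hm hE0 hEs hf i' j' k _ (hcar p hp hcp)).trans ?_
    exact mul_le_mul_of_nonneg_left (hsub p hp) (by positivity)
  induction n with
  | zero =>
    intro q hq hqc hsum
    have : q = 0 := by
      ext j
      exact (Finset.sum_eq_zero_iff_of_nonneg fun j _ => hqc.1 j).1 (by simpa using hsum) j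
        (Finset.mem_univ j)
    subst this
    simp
  | succ n ih =>
    intro q hq hqc hsum
    have hq0 : q ≠ 0 := by
      rintro rfl
      simp at hsum
      omega
    obtain ⟨j, hj, hpc⟩ := exists_pred (by omega) hqc hq0
    set p := q - Pi.single j 1 with hp
    have hqp : q = p + Pi.single j 1 := by rw [hp]; abel
    have hpt : p ∈ trits m := by
      rw [mem_trits] at hq ⊢
      intro l
      refine ⟨hpc.1 l, ?_⟩
      have := hq l
      by_cases hl : l = j
      · subst hl; simp [hp]; omega
      · simp [hp, hl, this]
    have hps : ∑ l, p l = n := by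
      rw [hqp] at hsum
      simp only [Pi.add_apply, Finset.sum_add_distrib, Finset.sum_pi_single', Finset.mem_univ,
        if_true, Nat.cast_succ] at hsum
      linarith
    have h1 := ih p hpt hpc hps
    have h2 := hD i j p hpt hpc
    have h3 := hD i j q hq hqc
    have hcq := hcar q hq hqc
    have hsq := hsub q hq
    rw [hqp, child_add_single'] at hcq hsq h3 ⊢
    have h4 := abs_colAvg_step_le hm hE0 hEs hf j k _ (hcar p hpt hpc) hcq (hsub p hpt) hsq
    push_cast
    rw [abs_le] at *
    constructor <;> linarith

lemma abs_colAvg_child_sub_zero' (i : Fin m) (k : ℕ) (z : Fin m → ℤ) (hz : inCarpet m z)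
    (q : Fin m → ℤ) (hq : q ∈ trits m) (hqc : ∃ j, q j ≠ 1) :
    |colAvg f i k (child z q) - colAvg f i k (child z 0)|
      ≤ 18 * m * resRoot m ^ k * √(Eb (k + 1) z) := by
  have hqc' : inCarpet m q := by
    rw [← child_zero q]
    exact inCarpet_child (inCarpet_zero (by omega)) hq hqc
  have h0 : 0 ≤ ∑ j, q j := Finset.sum_nonneg fun j _ => hqc'.1 j
  obtain ⟨n, hn⟩ := Int.eq_ofNat_of_zero_le h0
  have hn2 : (n : ℤ) ≤ 2 * m := by
    rw [← hn]
    calc ∑ j, q j ≤ ∑ _j : Fin m, 2 := Finset.sum_le_sum fun j _ => (mem_trits.1 hq j).2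
      _ = 2 * m := by simp [mul_comm]
  have hn2 : (n : ℝ) ≤ 2 * m := by exact_mod_cast hn2
  have hr := resRoot_pos hm
  refine (abs_colAvg_child_sub_zero hm hE0 hEs hf i k z hz n q hq hqc' hn).trans ?_
  calc (n : ℝ) * (9 * resRoot m ^ k * √(Eb (k + 1) z))
      ≤ (2 * m) * (9 * resRoot m ^ k * √(Eb (k + 1) z)) := by gcongr
    _ = _ := by ring

lemma abs_colAvg_succ_sub_child (i : Fin m) (k : ℕ) (z : Fin m → ℤ) (hz : inCarpet m z)
    (q : Fin m → ℤ) (hq : q ∈ trits m) (hqc : ∃ j, q j ≠ 1) :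
    |colAvg f i k (child z q) - colAvg f i (k + 1) z|
      ≤ 36 * m * resRoot m ^ k * √(Eb (k + 1) z) := by
  have h27 := three_pow_ge hm
  have hM : (0 : ℝ) < 3 ^ m - 3 := by linarith
  have h1 := abs_colAvg_child_sub_zero' hm hE0 hEs hf i k z hz q hq hqc
  have h2 : |colAvg f i (k + 1) z - colAvg f i k (child z 0)|
      ≤ 18 * m * resRoot m ^ k * √(Eb (k + 1) z) := by
    have e : colAvg f i (k + 1) z - colAvg f i k (child z 0)
        = (∑ q ∈ colSet i, (colAvg f i k (child z q) - colAvg f i k (child z 0)))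
          / (3 ^ m - 3) := by
      rw [Finset.sum_sub_distrib, Finset.sum_const, nsmul_eq_mul, card_colSet, sub_div,
        mul_div_cancel_left₀ _ hM.ne']
      rfl
    rw [e, abs_div, abs_of_pos hM, div_le_iff₀ hM]
    refine (Finset.abs_sum_le_sum_abs _ _).trans ?_
    refine (Finset.sum_le_card_nsmul _ _ (18 * m * resRoot m ^ k * √(Eb (k + 1) z))
      fun q hq => abs_colAvg_child_sub_zero' hm hE0 hEs hf i k z hz q (colSet_subset i hq)
        (exists_ne_one_of_mem_colSet hq)).trans ?_
    rw [nsmul_eq_mul, card_colSet, mul_comm]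
  rw [abs_le] at *
  constructor <;> linarith

lemma abs_le_sum_blocks {K : ℕ} (hK : ∀ y, f y ≠ 0 → ∀ i, y i < 3 ^ K) {x : Fin m → ℤ}
    (hx : inCarpet m x) (hfx : f x ≠ 0) :
    |f x| ≤ ∑ k ∈ Finset.range (K + 1),
      36 * m * resRoot m ^ k * √(Eb (k + 1) (blockIdx (k + 1) x)) := by
  have i : Fin m := ⟨0, by omega⟩
  have hstep : ∀ k, |f x| ≤ ∑ k ∈ Finset.range k,
      36 * m * resRoot m ^ k * √(Eb (k + 1) (blockIdx (k + 1) x)) +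
        |colAvg f i k (blockIdx k x)| := by
    intro k
    induction k with
    | zero => simp [colAvg, blockIdx_zero]
    | succ k ih =>
      obtain ⟨q, hq, hqe⟩ := blockIdx_eq_child k x
      have hc : inCarpet m (child (blockIdx (k + 1) x) q) := hqe ▸ inCarpet_blockIdx hx k
      have h := abs_colAvg_succ_sub_child hm hE0 hEs hf i k (blockIdx (k + 1) x)
        (inCarpet_blockIdx hx (k + 1)) q hq (exists_ne_one_of_inCarpet_child hc)
      rw [← hqe] at h
      rw [Finset.sum_range_succ]
      have := abs_sub_abs_le_abs_sub (colAvg f i k (blockIdx k x))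
        (colAvg f i (k + 1) (blockIdx (k + 1) x))
      linarith
  have hb : ∀ k, K ≤ k → blockIdx k x = 0 := by
    intro k hk
    ext j
    refine Int.ediv_eq_zero_of_lt (hx.1 j) ((hK x hfx j).trans_le ?_)
    exact pow_le_pow_right₀ (by norm_num) hk
  refine (hstep K).trans ?_
  rw [Finset.sum_range_succ]
  gcongr
  rw [hb K le_rfl, hb (K + 1) (by omega)]
  have hz := inCarpet_zero (m := m) (by omega)
  have hq : (Pi.single i 1 : Fin m → ℤ) ∈ trits m := by
    rw [mem_trits]
    intro l
    by_cases hl : l = i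
    · subst hl; simp
    · simp [hl]
  have hq1 : ∃ j, (Pi.single i 1 : Fin m → ℤ) j ≠ 1 := by
    have : Nontrivial (Fin m) := Fin.nontrivial_iff_two_le.2 (by omega)
    obtain ⟨j, hj⟩ := exists_ne i
    exact ⟨j, by simp [hj]⟩
  have h := abs_colAvg_child_sub_zero' hm hE0 hEs hf i K 0 hz _ hq hq1
  rw [child_zero, child_zero, colAvg_eq_zero i K (Pi.single i 1), zero_sub, abs_neg] at h
  · refine h.trans ?_
    have := resRoot_pos hm
    gcongr
    norm_num
  · intro y hy
    by_contra hne
    have h1 := hK y hne i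
    have h2 := congrFun hy i
    simp only [blockIdx, Pi.single_eq_same] at h2
    have h3 := Int.ediv_mul_le (y i) (b := 3 ^ K) (by positivity)
    rw [h2] at h3
    linarith
end

/-- The sum of `e` over the points of `S` in a block. -/
noncomputable def blockSum (S : Finset (Fin m → ℤ)) (e : (Fin m → ℤ) → ℝ) (k : ℕ)
    (z : Fin m → ℤ) : ℝ := ∑ x ∈ S with blockIdx k x = z, e x

lemma sum_blockSum_le (S : Finset (Fin m → ℤ)) {e : (Fin m → ℤ) → ℝ} (he : ∀ x, 0 ≤ e x) (k : ℕ)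
    (Z : Finset (Fin m → ℤ)) : ∑ z ∈ Z, blockSum S e k z ≤ ∑ x ∈ S, e x := by
  unfold blockSum
  rw [← Finset.sum_biUnion]
  · refine Finset.sum_le_sum_of_subset_of_nonneg ?_ fun _ _ _ => he _
    intro x hx
    simp only [Finset.mem_biUnion, Finset.mem_filter] at hx
    obtain ⟨_, _, hx, _⟩ := hx
    exact hx
  · intro z _ z' _ hzz
    simp only [Function.onFun, Finset.disjoint_left, Finset.mem_filter]
    rintro x ⟨_, rfl⟩ ⟨_, h⟩
    exact hzz h

lemma sum_child_blockSum_le (S : Finset (Fin m → ℤ)) {e : (Fin m → ℤ) → ℝ} (he : ∀ x, 0 ≤ e x)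
    (k : ℕ) (z : Fin m → ℤ) :
    ∑ q ∈ trits m, blockSum S e k (child z q) ≤ blockSum S e (k + 1) z := by
  have h := sum_blockSum_le (S.filter fun x => blockIdx (k + 1) x = z) he k
    ((trits m).map ⟨child z, child_injective z⟩)
  rw [Finset.sum_map] at h
  refine le_trans (Finset.sum_le_sum fun q hq => ?_) h
  simp only [blockSum, Function.Embedding.coeFn_mk]
  refine Finset.sum_le_sum_of_subset_of_nonneg ?_ fun _ _ _ => he _
  intro x hx
  simp only [Finset.mem_filter] at hx ⊢
  refine ⟨⟨hx.1, ?_⟩, hx.2⟩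
  ext j
  rw [blockIdx_succ, hx.2]
  have := mem_trits.1 hq j
  simp only [child]
  omega

/-- If a set `A` has at most `b ^ k` points in each block of level `k`, then the energy of
any finitely supported function which is one on `A` is at least of order `|A| ^ γ`. -/
theorem exists_energy_lower_bound (hm : 3 ≤ m) {b γ : ℝ} (hb : 1 ≤ b) (hγ0 : 0 ≤ γ) (hγ1 : γ ≤ 1)
    (hbγ : 9 / (3 ^ m - 3) * b ^ γ < 1) :
    ∃ c : ℝ, 0 < c ∧ ∀ (S A : Finset (Fin m → ℤ)) (e f : (Fin m → ℤ) → ℝ), (∀ x, 0 ≤ e x) →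
      (∀ z i, inCarpet m z → inCarpet m (z + Pi.single i 1) →
        (f (z + Pi.single i 1) - f z) ^ 2 ≤ if z ∈ S then e z else 0) →
      (∀ x ∈ A, inCarpet m x ∧ f x = 1) → (∃ K : ℕ, ∀ y, f y ≠ 0 → ∀ i, y i < 3 ^ K) →
      (∀ k z, (((A.filter fun x => blockIdx k x = z).card : ℕ) : ℝ) ≤ b ^ k) →
      A.Nonempty → c * (A.card : ℝ) ^ γ ≤ ∑ x ∈ S, e x := by
  have hr := resRoot_pos hm
  have hbp : 0 < b ^ γ := Real.rpow_pos_of_pos (by linarith) _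
  set t := √(b ^ γ) with ht
  have ht0 : 0 < t := Real.sqrt_pos.2 hbp
  have htt : t ^ 2 = b ^ γ := Real.sq_sqrt hbp.le
  have hrt : resRoot m * t < 1 := by
    have : (resRoot m * t) ^ 2 < 1 := by rwa [mul_pow, resRoot_sq hm, htt]
    nlinarith [mul_pos hr ht0]
  have hm0 : (0 : ℝ) < m := by exact_mod_cast (by omega : 0 < m)
  set C := 36 * m * t * (1 - resRoot m * t)⁻¹ with hC
  have hC0 : 0 < C := by
    have : 0 < 1 - resRoot m * t := by linarith
    positivity
  refine ⟨(C ^ 2)⁻¹, by positivity, ?_⟩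
  rintro S A e f he hfe hA ⟨K, hK⟩ hcard hne
  set n : ℝ := ((A.card : ℕ) : ℝ) with hn
  have hn0 : 0 < n := by
    rw [hn]
    exact_mod_cast hne.card_pos
  set Et := ∑ x ∈ S, e x with hEt
  have hEt0 : 0 ≤ Et := Finset.sum_nonneg fun _ _ => he _
  have hE0 : ∀ k z, 0 ≤ blockSum S e k z := fun k z => Finset.sum_nonneg fun _ _ => he _
  have hbs0 : ∀ z, blockSum S e 0 z = if z ∈ S then e z else 0 := by
    intro z
    simp only [blockSum, blockIdx_zero]
    rw [Finset.sum_filter, Finset.sum_ite_eq']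
  have hf : ∀ z i, inCarpet m z → inCarpet m (z + Pi.single i 1) →
      |f (z + Pi.single i 1) - f z| ≤ √(blockSum S e 0 z) := by
    intro z i hz hz'
    rw [hbs0]
    exact Real.abs_le_sqrt (hfe z i hz hz')
  have hpt : ∀ x ∈ A, (1 : ℝ) ≤ ∑ k ∈ Finset.range (K + 1),
      36 * m * resRoot m ^ k * √(blockSum S e (k + 1) (blockIdx (k + 1) x)) := by
    intro x hx
    have h1 := (hA x hx).2
    have := abs_le_sum_blocks hm hE0 (sum_child_blockSum_le S he) hf hK (hA x hx).1
      (by rw [h1]; norm_num)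
    rwa [h1, abs_one] at this
  have hlev : ∀ k, ∑ x ∈ A, blockSum S e k (blockIdx k x) ≤ n ^ (1 - γ) * (b ^ γ) ^ k * Et := by
    intro k
    rw [← Finset.sum_fiberwise_of_maps_to (t := A.image (blockIdx k)) (g := blockIdx k)
      (fun x hx => Finset.mem_image_of_mem _ hx)]
    calc ∑ z ∈ A.image (blockIdx k), ∑ x ∈ A with blockIdx k x = z, blockSum S e k (blockIdx k x)
        ≤ ∑ z ∈ A.image (blockIdx k), n ^ (1 - γ) * (b ^ γ) ^ k * blockSum S e k z := by
          refine Finset.sum_le_sum fun z hz => ?_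
          rw [Finset.sum_congr rfl (g := fun _ => blockSum S e k z)
            (fun x hx => by rw [(Finset.mem_filter.1 hx).2]), Finset.sum_const, nsmul_eq_mul]
          refine mul_le_mul_of_nonneg_right ?_ (hE0 _ _)
          set cz : ℝ := (((A.filter fun x => blockIdx k x = z).card : ℕ) : ℝ) with hcz
          have hcz0 : 0 < cz := by
            obtain ⟨x, hx, hxz⟩ := Finset.mem_image.1 hz
            have : 0 < (A.filter fun x => blockIdx k x = z).card :=
              Finset.card_pos.2 ⟨x, Finset.mem_filter.2 ⟨hx, hxz⟩⟩
            rw [hcz]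
            exact_mod_cast this
          have h1 : cz ≤ n := by
            rw [hcz, hn]
            exact_mod_cast Finset.card_filter_le _ _
          have h2 : cz ≤ b ^ k := hcard k z
          have h3 : (b ^ γ) ^ k = (b ^ k) ^ γ := by
            rw [← Real.rpow_natCast, ← Real.rpow_natCast, ← Real.rpow_mul (by linarith),
              ← Real.rpow_mul (by linarith), mul_comm]
          rw [h3]
          calc cz = cz ^ (1 - γ) * cz ^ γ := by
                rw [← Real.rpow_add hcz0]; simp
            _ ≤ n ^ (1 - γ) * (b ^ k) ^ γ := by
                gcongr
      _ = n ^ (1 - γ) * (b ^ γ) ^ k * ∑ z ∈ A.image (blockIdx k), blockSum S e k z := by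
          rw [Finset.mul_sum]
      _ ≤ _ := by
          have : 0 < n ^ (1 - γ) := Real.rpow_pos_of_pos hn0 _
          gcongr
          exact sum_blockSum_le S he k _
  have hmain : n ≤ C * √(n * n ^ (1 - γ) * Et) := by
    have hnp : 0 < n ^ (1 - γ) := Real.rpow_pos_of_pos hn0 _
    calc n = ∑ x ∈ A, (1 : ℝ) := by simp [hn]
      _ ≤ ∑ x ∈ A, ∑ k ∈ Finset.range (K + 1),
          36 * m * resRoot m ^ k * √(blockSum S e (k + 1) (blockIdx (k + 1) x)) :=
            Finset.sum_le_sum hpt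
      _ = ∑ k ∈ Finset.range (K + 1), 36 * m * resRoot m ^ k *
          ∑ x ∈ A, √(blockSum S e (k + 1) (blockIdx (k + 1) x)) := by
            rw [Finset.sum_comm]
            simp only [Finset.mul_sum]
      _ ≤ ∑ k ∈ Finset.range (K + 1), 36 * m * resRoot m ^ k *
          (t ^ (k + 1) * √(n * n ^ (1 - γ) * Et)) := by
            gcongr with k hk
            refine (sum_sqrt_le A (fun x => blockSum S e (k + 1) (blockIdx (k + 1) x))
              fun x => hE0 _ _).trans ?_
            rw [← Real.sqrt_mul (by positivity)]
            refine Real.sqrt_le_iff.2 ⟨by positivity, ?_⟩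
            rw [mul_pow, Real.sq_sqrt (by positivity), ← pow_mul, mul_comm (k + 1) 2, pow_mul, htt]
            calc (A.card : ℝ) * _ ≤ n * (n ^ (1 - γ) * (b ^ γ) ^ (k + 1) * Et) := by
                  gcongr
                  exact hlev (k + 1)
              _ = _ := by ring
      _ = 36 * m * t * (∑ k ∈ Finset.range (K + 1), (resRoot m * t) ^ k) *
            √(n * n ^ (1 - γ) * Et) := by
            generalize √(n * n ^ (1 - γ) * Et) = s
            rw [Finset.mul_sum, Finset.sum_mul]
            refine Finset.sum_congr rfl fun k _ => ?_
            ring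
      _ ≤ _ := by
            rw [hC]
            gcongr
            have hs := summable_geometric_of_lt_one (mul_pos hr ht0).le hrt
            rw [← tsum_geometric_of_lt_one (mul_pos hr ht0).le hrt]
            exact hs.sum_le_tsum _ fun _ _ => by positivity
  have hsq : n ^ 2 ≤ C ^ 2 * (n * n ^ (1 - γ) * Et) := by
    have hnp : 0 < n ^ (1 - γ) := Real.rpow_pos_of_pos hn0 _
    calc n ^ 2 ≤ (C * √(n * n ^ (1 - γ) * Et)) ^ 2 := by gcongr
      _ = _ := by rw [mul_pow, Real.sq_sqrt (by positivity)]
  have hnγ : n ^ (1 - γ) * n ^ γ = n := by rw [← Real.rpow_add hn0]; simp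
  have hnp : 0 < n ^ (1 - γ) := Real.rpow_pos_of_pos hn0 _
  rw [inv_mul_le_iff₀ (by positivity)]
  have : n * n ^ (1 - γ) * n ^ γ ≤ n * n ^ (1 - γ) * (C ^ 2 * Et) := by
    calc n * n ^ (1 - γ) * n ^ γ = n ^ 2 := by rw [mul_assoc, hnγ]; ring
      _ ≤ _ := hsq
      _ = _ := by ring
  exact le_of_mul_le_mul_left this (by positivity)

end

/-! ### Hitting distributions and the Laplacian -/

section
variable {V : Type*} {nbr : V → Finset V} {A : Set V}

theorem hitP_of_mem {x : V} (hx : x ∈ A) (n : ℕ) (y : V) [Decidable (x = y)] :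
    hitP nbr A n x y = if x = y then 1 else 0 := by
  cases n <;> simp [hitP, hx]

theorem hitP_nonneg (n : ℕ) (x y : V) : 0 ≤ hitP nbr A n x y := by
  induction n generalizing x with
  | zero => unfold hitP; split_ifs <;> norm_num
  | succ n ih =>
    unfold hitP
    split_ifs
    · norm_num
    · norm_num
    · exact mul_nonneg (by positivity) (Finset.sum_nonneg fun _ _ => ih _)

theorem sum_hitP_le_one (D : Finset V) (n : ℕ) (x : V) : ∑ y ∈ D, hitP nbr A n x y ≤ 1 := by
  classical
  have hmem : ∀ x ∈ A, ∀ n, ∑ y ∈ D, hitP nbr A n x y ≤ 1 := by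
    intro x hx n
    simp only [hitP_of_mem hx, Finset.sum_ite_eq]
    split_ifs <;> norm_num
  induction n generalizing x with
  | zero =>
    by_cases hx : x ∈ A
    · exact hmem x hx 0
    · simp [hitP, hx]
  | succ n ih =>
    by_cases hx : x ∈ A
    · exact hmem x hx _
    · simp only [hitP, hx, if_false]
      rw [← Finset.mul_sum, Finset.sum_comm]
      rcases (nbr x).eq_empty_or_nonempty with h | h
      · simp [h]
      · rw [inv_mul_le_iff₀ (by exact_mod_cast h.card_pos), mul_one]
        simpa using Finset.sum_le_sum fun z (_ : z ∈ nbr x) => ih z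

theorem hitP_le_one (n : ℕ) (x y : V) : hitP nbr A n x y ≤ 1 := by
  simpa using sum_hitP_le_one (nbr := nbr) (A := A) {y} n x

theorem hitP_le_succ (n : ℕ) (x y : V) : hitP nbr A n x y ≤ hitP nbr A (n + 1) x y := by
  classical
  by_cases hx : x ∈ A
  · rw [hitP_of_mem hx, hitP_of_mem hx]
  induction n generalizing x with
  | zero =>
    have : hitP nbr A 0 x y = 0 := by simp [hitP, hx]
    rw [this]
    exact hitP_nonneg _ _ _
  | succ n ih =>
    rw [hitP, hitP, if_neg hx, if_neg hx]
    refine mul_le_mul_of_nonneg_left (Finset.sum_le_sum fun z _ => ?_) (by positivity)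
    by_cases hz : z ∈ A
    · rw [hitP_of_mem hz, hitP_of_mem hz]
    · exact ih z hz

theorem bddAbove_hitP (x y : V) : BddAbove (Set.range fun n => hitP nbr A n x y) :=
  ⟨1, by rintro _ ⟨n, rfl⟩; exact hitP_le_one n x y⟩

theorem hitP_le_hitMeas (n : ℕ) (x y : V) : hitP nbr A n x y ≤ hitMeas nbr A x y :=
  le_ciSup (bddAbove_hitP x y) n

theorem tendsto_hitP (x y : V) :
    Tendsto (fun n => hitP nbr A n x y) atTop (𝓝 (hitMeas nbr A x y)) :=
  tendsto_atTop_ciSup (monotone_nat_of_le_succ fun n => hitP_le_succ n x y) (bddAbove_hitP x y)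

theorem hitMeas_nonneg (x y : V) : 0 ≤ hitMeas nbr A x y :=
  (hitP_nonneg 0 x y).trans (hitP_le_hitMeas 0 x y)

theorem sum_hitMeas_le_one (D : Finset V) (x : V) : ∑ y ∈ D, hitMeas nbr A x y ≤ 1 :=
  le_of_tendsto (tendsto_finsetSum D fun y _ => tendsto_hitP x y)
    (Eventually.of_forall fun n => sum_hitP_le_one D n x)

theorem hitMeas_of_mem {x : V} (hx : x ∈ A) (y : V) [Decidable (x = y)] :
    hitMeas nbr A x y = if x = y then 1 else 0 := by
  simp [hitMeas, hitP_of_mem hx]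

theorem hitMeas_of_notMem {x : V} (hx : x ∉ A) (y : V) :
    hitMeas nbr A x y = ((nbr x).card : ℝ)⁻¹ * ∑ z ∈ nbr x, hitMeas nbr A z y := by
  refine tendsto_nhds_unique ((tendsto_add_atTop_iff_nat 1).2 (tendsto_hitP x y)) ?_
  have h : (fun n => hitP nbr A (n + 1) x y) =
      fun n => ((nbr x).card : ℝ)⁻¹ * ∑ z ∈ nbr x, hitP nbr A n z y := by
    funext n
    rw [hitP, if_neg hx]
  rw [h]
  exact (tendsto_finsetSum _ fun z _ => tendsto_hitP z y).const_mul _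

/-- Enlarging the target decreases the probability to hit it at a given point of the original
target. -/
theorem hitMeas_union_le (C : Set V) (x : V) {y : V} (hy : y ∈ A) :
    hitMeas nbr (A ∪ C) x y ≤ hitMeas nbr A x y := by
  classical
  refine ciSup_mono (bddAbove_hitP x y) fun n => ?_
  induction n generalizing x with
  | zero =>
    by_cases hx : x = y
    · subst hx; simp [hitP, hy]
    · simp [hitP, hx]
  | succ n ih =>
    by_cases hx : x ∈ A
    · rw [hitP_of_mem hx, hitP_of_mem (Set.mem_union_left _ hx)]
    by_cases hxC : x ∈ A ∪ C
    · rw [hitP_of_mem hxC, if_neg (by rintro rfl; exact hx hy)]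
      exact hitP_nonneg _ _ _
    · rw [hitP, hitP, if_neg hx, if_neg hxC]
      exact mul_le_mul_of_nonneg_left (Finset.sum_le_sum fun z _ => ih z) (by positivity)

/-- In finitely many steps, the walk only sees a finite set. -/
theorem exists_hitP_eq_hitP_union_compl [DecidableEq V] (n : ℕ) (x y : V) :
    ∃ B₁ : Finset V, ∀ B : Finset V, B₁ ⊆ B →
      hitP nbr (A ∪ (↑B)ᶜ) n x y = hitP nbr A n x y := by
  induction n generalizing x with
  | zero =>
    refine ⟨{x}, fun B hB => ?_⟩
    have : x ∈ B := hB (Finset.mem_singleton_self x)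
    by_cases hx : x ∈ A
    · rw [hitP_of_mem hx, hitP_of_mem (Set.mem_union_left _ hx)]
    · have hx' : x ∉ A ∪ (↑B : Set V)ᶜ := by simp [hx, this]
      simp only [hitP, hx, hx', false_and]
  | succ n ih =>
    choose B₁ hB₁ using ih
    refine ⟨insert x ((nbr x).biUnion B₁), fun B hB => ?_⟩
    have hxB : x ∈ B := hB (Finset.mem_insert_self _ _)
    by_cases hx : x ∈ A
    · rw [hitP_of_mem hx, hitP_of_mem (Set.mem_union_left _ hx)]
    · have hx' : x ∉ A ∪ (↑B : Set V)ᶜ := by simp [hx, hxB]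
      rw [hitP, hitP, if_neg hx, if_neg hx']
      congr 1
      refine Finset.sum_congr rfl fun z hz => hB₁ z B fun w hw => hB ?_
      exact Finset.mem_insert_of_mem (Finset.mem_biUnion.2 ⟨z, hz, hw⟩)

/-- The graph Laplacian. -/
def lapl (nbr : V → Finset V) (f : V → ℝ) (x : V) : ℝ := ∑ z ∈ nbr x, (f x - f z)

theorem lapl_sum {ι : Type*} (s : Finset ι) (f : ι → V → ℝ) (x : V) :
    lapl nbr (fun x => ∑ i ∈ s, f i x) x = ∑ i ∈ s, lapl nbr (f i) x := by
  simp only [lapl, ← Finset.sum_sub_distrib]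
  exact Finset.sum_comm

theorem lapl_hitMeas {x : V} (hx : x ∉ A) (y : V) :
    lapl nbr (fun x => hitMeas nbr A x y) x = 0 := by
  rw [lapl, Finset.sum_sub_distrib, Finset.sum_const, nsmul_eq_mul, hitMeas_of_notMem hx]
  rcases (nbr x).eq_empty_or_nonempty with h | h
  · simp [h]
  · have : ((nbr x).card : ℝ) ≠ 0 := by exact_mod_cast h.card_ne_zero
    rw [mul_inv_cancel_left₀ this, sub_self]

variable [DecidableEq V] (hs : ∀ x z, z ∈ nbr x → x ∈ nbr z)
include hs

theorem sum_mul_lapl_comm {B : Finset V} {u g : V → ℝ} (hu : ∀ x ∉ B, u x = 0)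
    (hg : ∀ x ∉ B, g x = 0) :
    ∑ x ∈ B, u x * lapl nbr g x = ∑ x ∈ B, g x * lapl nbr u x := by
  have key : ∀ u g : V → ℝ, (∀ x ∉ B, g x = 0) → ∑ x ∈ B, u x * lapl nbr g x =
      ∑ x ∈ B, (nbr x).card * (u x * g x) -
        ∑ x ∈ B, ∑ z ∈ B, if z ∈ nbr x then u x * g z else 0 := by
    intro u g hg
    rw [← Finset.sum_sub_distrib]
    refine Finset.sum_congr rfl fun x _ => ?_
    have : ∑ z ∈ B, (if z ∈ nbr x then u x * g z else 0) = ∑ z ∈ nbr x, u x * g z := by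
      rw [← Finset.sum_filter, Finset.filter_mem_eq_inter]
      refine Finset.sum_subset Finset.inter_subset_right fun z hz hz' => ?_
      rw [hg z fun h => hz' (Finset.mem_inter.2 ⟨h, hz⟩), mul_zero]
    rw [this, lapl, Finset.mul_sum]
    simp only [mul_sub, Finset.sum_sub_distrib, Finset.sum_const, nsmul_eq_mul]
  rw [key u g hg, key g u hu]
  congr 1
  · exact Finset.sum_congr rfl fun x _ => by ring
  · rw [Finset.sum_comm]
    refine Finset.sum_congr rfl fun x _ => Finset.sum_congr rfl fun z _ => ?_
    by_cases h : z ∈ nbr x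
    · rw [if_pos h, if_pos (hs _ _ h), mul_comm]
    · rw [if_neg h, if_neg fun h' => h (hs _ _ h')]

theorem sum_sq_sub_eq {B S : Finset V} {u : V → ℝ} (hu : ∀ x ∉ B, u x = 0) (hBS : B ⊆ S)
    (hnS : ∀ x ∈ B, nbr x ⊆ S) :
    ∑ x ∈ S, ∑ z ∈ nbr x, (u x - u z) ^ 2 = 2 * ∑ x ∈ B, u x * lapl nbr u x := by
  have huS : ∀ x ∉ S, u x = 0 := fun x hx => hu x fun h => hx (hBS h)
  have h1 : ∑ x ∈ B, u x * lapl nbr u x = ∑ x ∈ S, u x * lapl nbr u x := by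
    refine Finset.sum_subset hBS fun x _ hx => ?_
    rw [hu x hx, zero_mul]
  have h2 : ∑ x ∈ S, ∑ z ∈ nbr x, u z * (u x - u z) = - ∑ x ∈ S, u x * lapl nbr u x := by
    have e1 : ∀ x ∈ S, ∑ z ∈ nbr x, u z * (u x - u z) =
        ∑ z ∈ S, if z ∈ nbr x then u z * (u x - u z) else 0 := by
      intro x _
      rw [← Finset.sum_filter, Finset.filter_mem_eq_inter]
      symm
      refine Finset.sum_subset Finset.inter_subset_right fun z hz hz' => ?_
      rw [huS z fun h => hz' (Finset.mem_inter.2 ⟨h, hz⟩), zero_mul]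
    rw [Finset.sum_congr rfl e1, Finset.sum_comm, ← Finset.sum_neg_distrib]
    refine Finset.sum_congr rfl fun z _ => ?_
    by_cases hzB : z ∈ B
    · rw [lapl, Finset.mul_sum, ← Finset.sum_neg_distrib]
      rw [← Finset.sum_filter]
      have : S.filter (fun x => z ∈ nbr x) = nbr z := by
        ext x
        rw [Finset.mem_filter]
        exact ⟨fun h => hs _ _ h.2, fun h => ⟨hnS z hzB h, hs _ _ h⟩⟩
      rw [this]
      exact Finset.sum_congr rfl fun x _ => by ring
    · simp [hu z hzB]
  have h3 : ∀ x ∈ S, ∑ z ∈ nbr x, (u x - u z) ^ 2 =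
      u x * lapl nbr u x - ∑ z ∈ nbr x, u z * (u x - u z) := by
    intro x _
    rw [lapl, Finset.mul_sum, ← Finset.sum_sub_distrib]
    exact Finset.sum_congr rfl fun z _ => by ring
  rw [Finset.sum_congr rfl h3, Finset.sum_sub_distrib, h2, h1]
  ring

/-- A lower bound for the capacity of `A` yields an upper bound on the killed hitting
probabilities of a point of `A`, from some point outside of a given finite set. -/
theorem exists_hitMeas_union_compl_le {A F B : Finset V} {c : ℝ} (hc : 0 < c) (hAF : A ⊆ F)
    (hFB : F ∪ F.biUnion nbr ⊆ B)
    (hcap : ∀ u : V → ℝ, (∀ x ∈ A, u x = 1) → (∀ x ∉ B, u x = 0) →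
      c ≤ ∑ x ∈ B, u x * lapl nbr u x) {y : V} (hy : y ∈ A) :
    ∃ x ∈ F.biUnion nbr \ F, c * hitMeas nbr (↑A ∪ (↑B)ᶜ) x y ≤
      (nbr y).card * ∑ z ∈ A, hitMeas nbr (↑A ∪ (↑B)ᶜ) x z := by
  set D := F ∪ F.biUnion nbr with hD
  have hAD : A ⊆ D := hAF.trans Finset.subset_union_left
  have hAB : A ⊆ B := hAD.trans hFB
  set g : V → ℝ := fun x => ∑ z ∈ D, hitMeas nbr (↑D ∪ (↑B)ᶜ) x z with hg
  set v : V → V → ℝ := fun y x => hitMeas nbr (↑A ∪ (↑B)ᶜ) x y with hv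
  set u : V → ℝ := fun x => ∑ z ∈ A, v z x with hu
  have sum_one : ∀ (A : Finset V) (x : V), x ∈ A →
      ∑ z ∈ A, hitMeas nbr (↑A ∪ (↑B)ᶜ) x z = 1 := by
    intro A x hx
    have : x ∈ (↑A ∪ (↑B)ᶜ : Set V) := Or.inl hx
    simp [hitMeas_of_mem this, hx]
  have off : ∀ (A : Finset V) (x y : V), A ⊆ B → x ∉ B → y ∈ A →
      hitMeas nbr (↑A ∪ (↑B)ᶜ) x y = 0 := by
    intro A x y hAB hx hy
    have : x ∈ (↑A ∪ (↑B)ᶜ : Set V) := Or.inr hx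
    rw [hitMeas_of_mem this, if_neg]
    rintro rfl
    exact hx (hAB hy)
  have hg0 : ∀ x ∉ B, g x = 0 := fun x hx => Finset.sum_eq_zero fun z hz => off D x z hFB hx hz
  have hv0 : ∀ y ∈ A, ∀ x ∉ B, v y x = 0 := fun y hy x hx => off A x y hAB hx hy
  have hu0 : ∀ x ∉ B, u x = 0 := fun x hx => Finset.sum_eq_zero fun z hz => hv0 z hz x hx
  have hg1 : ∀ x ∈ D, g x = 1 := sum_one D
  have hu1 : ∀ x ∈ A, u x = 1 := sum_one A
  have hLg : ∀ x ∈ B, x ∉ D → lapl nbr g x = 0 := by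
    intro x hxB hx
    rw [hg, lapl_sum]
    exact Finset.sum_eq_zero fun z _ => lapl_hitMeas (by simp [hx, hxB]) z
  have hLv : ∀ y, ∀ x ∈ B, x ∉ A → lapl nbr (v y) x = 0 := by
    intro y x hxB hx
    exact lapl_hitMeas (by simp [hx, hxB]) y
  have hLu : ∀ x ∈ B, x ∉ A → lapl nbr u x = 0 := by
    intro x hxB hx
    rw [hu, lapl_sum]
    exact Finset.sum_eq_zero fun z _ => hLv z x hxB hx
  have hLgF : ∀ x ∈ F, lapl nbr g x = 0 := by
    intro x hx
    refine Finset.sum_eq_zero fun z hz => ?_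
    rw [hg1 x (Finset.mem_union_left _ hx),
      hg1 z (Finset.mem_union_right _ (Finset.mem_biUnion.2 ⟨x, hx, hz⟩)), sub_self]
  have hLg0 : ∀ x ∈ D, 0 ≤ lapl nbr g x := by
    intro x hx
    refine Finset.sum_nonneg fun z _ => ?_
    rw [hg1 x hx]
    linarith [sum_hitMeas_le_one (nbr := nbr) (A := ↑D ∪ (↑B)ᶜ) D z]
  have hDF : F.biUnion nbr \ F ⊆ B :=
    (Finset.sdiff_subset.trans Finset.subset_union_right).trans hFB
  have red : ∀ w : V → ℝ, ∑ x ∈ B, w x * lapl nbr g x =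
      ∑ x ∈ F.biUnion nbr \ F, w x * lapl nbr g x := by
    intro w
    refine (Finset.sum_subset hDF fun x hxB hx => ?_).symm
    by_cases hxF : x ∈ F
    · rw [hLgF x hxF, mul_zero]
    · rw [hLg x hxB, mul_zero]
      intro hxD
      rcases Finset.mem_union.1 hxD with h | h
      · exact hxF h
      · exact hx (Finset.mem_sdiff.2 ⟨h, hxF⟩)
  have redA : ∀ w h : V → ℝ, (∀ x ∈ B, x ∉ A → lapl nbr w x = 0) → (∀ x ∈ A, h x = 1) →
      ∑ x ∈ B, h x * lapl nbr w x = ∑ x ∈ A, lapl nbr w x := by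
    intro w h hw hh
    rw [← Finset.sum_subset hAB fun x hxB hx => by rw [hw x hxB hx, mul_zero]]
    exact Finset.sum_congr rfl fun x hx => by rw [hh x hx, one_mul]
  have hsumu : c ≤ ∑ x ∈ F.biUnion nbr \ F, u x * lapl nbr g x := by
    rw [← red, sum_mul_lapl_comm hs hu0 hg0, redA u g hLu fun x hx => hg1 x (hAD hx),
      ← redA u u hLu hu1]
    exact hcap u hu1 hu0
  have hsumv : ∑ x ∈ F.biUnion nbr \ F, v y x * lapl nbr g x ≤ (nbr y).card := by
    rw [← red, sum_mul_lapl_comm hs (hv0 y hy) hg0,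
      redA (v y) g (hLv y) fun x hx => hg1 x (hAD hx)]
    calc ∑ x ∈ A, lapl nbr (v y) x ≤ ∑ x ∈ A, if x = y then ((nbr y).card : ℝ) else 0 := by
          refine Finset.sum_le_sum fun x hx => ?_
          have hxm : x ∈ (↑A ∪ (↑B)ᶜ : Set V) := Or.inl hx
          split_ifs with h
          · subst h
            calc lapl nbr (v x) x ≤ ∑ z ∈ nbr x, (1 : ℝ) := by
                  refine Finset.sum_le_sum fun z _ => ?_
                  have h1 : v x x = 1 := by simp [hv, hitMeas_of_mem hxm]
                  have h2 : 0 ≤ v x z := hitMeas_nonneg _ _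
                  linarith
              _ = _ := by simp
          · refine Finset.sum_nonpos fun z _ => ?_
            have h1 : v y x = 0 := by simp [hv, hitMeas_of_mem hxm, h]
            have h2 : 0 ≤ v y z := hitMeas_nonneg _ _
            linarith
      _ = _ := by simp [hy]
  by_contra! hcon
  have hpos : 0 < ∑ x ∈ F.biUnion nbr \ F,
      (c * v y x - (nbr y).card * u x) * lapl nbr g x := by
    have hnn : ∀ x ∈ F.biUnion nbr \ F,
        0 ≤ (c * v y x - (nbr y).card * u x) * lapl nbr g x := by
      intro x hx
      refine mul_nonneg (by linarith [hcon x hx]) (hLg0 x ?_)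
      exact Finset.mem_union_right _ (Finset.mem_sdiff.1 hx).1
    refine lt_of_le_of_ne (Finset.sum_nonneg hnn) fun h => ?_
    have hz := (Finset.sum_eq_zero_iff_of_nonneg hnn).1 h.symm
    have : ∑ x ∈ F.biUnion nbr \ F, u x * lapl nbr g x = 0 := by
      refine Finset.sum_eq_zero fun x hx => ?_
      rcases mul_eq_zero.1 (hz x hx) with h | h
      · linarith [hcon x hx]
      · rw [h, mul_zero]
    linarith
  have hsplit : ∑ x ∈ F.biUnion nbr \ F, (c * v y x - (nbr y).card * u x) * lapl nbr g x =
      c * ∑ x ∈ F.biUnion nbr \ F, v y x * lapl nbr g x -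
        (nbr y).card * ∑ x ∈ F.biUnion nbr \ F, u x * lapl nbr g x := by
    rw [Finset.mul_sum, Finset.mul_sum, ← Finset.sum_sub_distrib]
    exact Finset.sum_congr rfl fun x _ => by ring
  have h1 := mul_le_mul_of_nonneg_left hsumv hc.le
  have h2 : ((nbr y).card : ℝ) * c ≤ (nbr y).card * ∑ x ∈ F.biUnion nbr \ F, u x * lapl nbr g x :=
    mul_le_mul_of_nonneg_left hsumu (by positivity)
  linarith

/-- A lower bound for the capacity of `A` yields an upper bound for the harmonic measure from
infinity of `A`. -/
theorem harmonic_measure_le {A : Finset V} {c μ : ℝ} (hc : 0 < c)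
    (hcap : ∀ (B : Finset V) (u : V → ℝ), (∀ x ∈ A, u x = 1) → (∀ x ∉ B, u x = 0) →
      c ≤ ∑ x ∈ B, u x * lapl nbr u x) {y : V} (hy : y ∈ A)
    (hμ : Tendsto (fun x => hitMeas nbr (↑A) x y / ∑ z ∈ A, hitMeas nbr (↑A) x z)
      cofinite (𝓝 μ)) : μ ≤ (nbr y).card / c := by
  by_contra! hlt
  have hfin := hμ.eventually (lt_mem_nhds hlt)
  rw [eventually_cofinite] at hfin
  set F := A ∪ hfin.toFinset with hF
  have key : ∃ x ∉ F, ∀ B₁ : Finset V, ∃ B, B₁ ⊆ B ∧ c * hitMeas nbr (↑A ∪ (↑B)ᶜ) x y ≤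
      (nbr y).card * ∑ z ∈ A, hitMeas nbr (↑A ∪ (↑B)ᶜ) x z := by
    by_contra! hcon
    have hcon' : ∀ x, ∃ B₁ : Finset V, x ∉ F → ∀ B, B₁ ⊆ B →
        (nbr y).card * ∑ z ∈ A, hitMeas nbr (↑A ∪ (↑B)ᶜ) x z <
          c * hitMeas nbr (↑A ∪ (↑B)ᶜ) x y := by
      intro x
      by_cases hx : x ∈ F
      · exact ⟨∅, fun h => absurd hx h⟩
      · obtain ⟨B₁, hB₁⟩ := hcon x hx
        exact ⟨B₁, fun _ => hB₁⟩
    choose B₁ hB₁ using hcon'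
    obtain ⟨x, hx, hle⟩ := exists_hitMeas_union_compl_le hs (A := A) (F := F)
      (B := (F ∪ F.biUnion nbr) ∪ (F.biUnion nbr).biUnion B₁) hc Finset.subset_union_left
      Finset.subset_union_left (hcap _) hy
    rw [Finset.mem_sdiff] at hx
    refine absurd hle (not_le.2 (hB₁ x hx.2 _ ?_))
    exact (Finset.subset_biUnion_of_mem B₁ hx.1).trans Finset.subset_union_right
  obtain ⟨x, hxF, hx⟩ := key
  have hxlt : (nbr y).card / c < hitMeas nbr (↑A) x y / ∑ z ∈ A, hitMeas nbr (↑A) x z := by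
    by_contra h
    exact hxF (Finset.mem_union_right _ (hfin.mem_toFinset.2 h))
  refine absurd hxlt (not_lt.2 ?_)
  have hle : c * hitMeas nbr (↑A) x y ≤ (nbr y).card * ∑ z ∈ A, hitMeas nbr (↑A) x z := by
    have : Tendsto (fun n => c * hitP nbr (↑A) n x y) atTop (𝓝 (c * hitMeas nbr (↑A) x y)) :=
      (tendsto_hitP x y).const_mul c
    refine le_of_tendsto this (Eventually.of_forall fun n => ?_)
    obtain ⟨B₁, hB₁⟩ := exists_hitP_eq_hitP_union_compl (nbr := nbr) (A := ↑A) n x y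
    obtain ⟨B, hB, hle⟩ := hx B₁
    calc c * hitP nbr (↑A) n x y = c * hitP nbr (↑A ∪ (↑B)ᶜ) n x y := by rw [hB₁ B hB]
      _ ≤ c * hitMeas nbr (↑A ∪ (↑B)ᶜ) x y := by gcongr; exact hitP_le_hitMeas n x y
      _ ≤ _ := hle
      _ ≤ _ := by
        gcongr with z hz
        exact hitMeas_union_le _ x hz
  rcases (Finset.sum_nonneg fun z (_ : z ∈ A) => hitMeas_nonneg (nbr := nbr) (A := ↑A) x z).eq_or_lt
    with h0 | h0
  · rw [← h0, div_zero]
    positivity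
  · rw [div_le_div_iff₀ h0 hc]
    linarith

end

/-! ### The carpet graph -/

section
variable {m : ℕ}

instance : Countable (CarpetV m) := inferInstanceAs (Countable {x // inCarpet m x})

/-- The lattice point underlying a vertex. -/
def CarpetV.pt (x : CarpetV m) : Fin m → ℤ := x.1

theorem CarpetV.pt_injective : Function.Injective (CarpetV.pt (m := m)) :=
  fun _ _ h => Subtype.ext h

theorem mem_latNbrs {x y : Fin m → ℤ} :
    y ∈ latNbrs x ↔ ∃ i, y = x + Pi.single i 1 ∨ x = y + Pi.single i 1 := by
  have upd : ∀ (i : Fin m) (a : ℤ), Function.update x i (x i + a) = x + Pi.single i a := by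
    intro i a
    ext j
    rcases eq_or_ne j i with rfl | h
    · simp
    · simp [h]
  have hneg : ∀ i : Fin m, y = x + Pi.single i (-1) ↔ x = y + Pi.single i 1 := by
    intro i
    rw [Pi.single_neg, ← sub_eq_add_neg, eq_sub_iff_add_eq, eq_comm]
  simp only [latNbrs, Finset.mem_image, Finset.mem_product, Finset.mem_univ, true_and,
    Finset.mem_insert, Finset.mem_singleton, Prod.exists, upd]
  constructor
  · rintro ⟨i, a, rfl | rfl, h⟩
    · exact ⟨i, Or.inl h.symm⟩
    · exact ⟨i, Or.inr ((hneg i).1 h.symm)⟩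
  · rintro ⟨i, h | h⟩
    · exact ⟨i, 1, Or.inl rfl, h.symm⟩
    · exact ⟨i, -1, Or.inr rfl, ((hneg i).2 h).symm⟩

theorem mem_cNbrs {x y : CarpetV m} :
    y ∈ cNbrs x ↔ ∃ i, y.1 = x.1 + Pi.single i 1 ∨ x.1 = y.1 + Pi.single i 1 := by
  classical
  rw [← mem_latNbrs]
  exact Finset.mem_subtype

theorem mem_cNbrs_symm {x y : CarpetV m} (h : y ∈ cNbrs x) : x ∈ cNbrs y := by
  rw [mem_cNbrs] at h ⊢
  exact h.imp fun i => Or.symm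

theorem card_cNbrs_le (x : CarpetV m) : (cNbrs x).card ≤ 2 * m := by
  classical
  calc (cNbrs x).card ≤ (latNbrs x.1).card :=
        (Finset.card_subtype (inCarpet m) (latNbrs x.1)).trans_le (Finset.card_filter_le _ _)
    _ ≤ (Finset.univ ×ˢ ({1, -1} : Finset ℤ) : Finset (Fin m × ℤ)).card := Finset.card_image_le
    _ = 2 * m := by simp [Finset.card_product, mul_comm]

theorem sum_abs_sub_eq_one {x y : CarpetV m} (h : y ∈ cNbrs x) : ∑ i, |x.1 i - y.1 i| = 1 := by
  have key : ∀ (x : Fin m → ℤ) (i : Fin m),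
      ∑ j, |(Pi.single i 1 : Fin m → ℤ) j| = 1 := by
    intro x i
    rw [Finset.sum_eq_single i] <;> simp +contextual
  obtain ⟨i, h | h⟩ := mem_cNbrs.1 h
  · rw [← key x.1 i]
    exact Finset.sum_congr rfl fun j _ => by rw [h, Pi.add_apply, abs_sub_comm]; simp
  · rw [← key x.1 i]
    exact Finset.sum_congr rfl fun j _ => by rw [h, Pi.add_apply]; simp

/-- The supremum norm of a vertex. -/
def supN (x : CarpetV m) : ℕ := Finset.univ.sup fun i => (x.1 i).toNat

theorem toNat_le_supN (x : CarpetV m) (i : Fin m) : (x.1 i).toNat ≤ supN x :=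
  Finset.le_sup (f := fun i => (x.1 i).toNat) (Finset.mem_univ i)

theorem supN_le_succ {x y : CarpetV m} (h : y ∈ cNbrs x) : supN y ≤ supN x + 1 := by
  refine Finset.sup_le fun j _ => ?_
  have hj := toNat_le_supN x j
  obtain ⟨i, h | h⟩ := mem_cNbrs.1 h
  · have h' := congrFun h j
    rw [Pi.add_apply, Pi.single_apply] at h'
    split_ifs at h' <;> omega
  · have h' := congrFun h j
    rw [Pi.add_apply, Pi.single_apply] at h'
    split_ifs at h' <;> omega

theorem mem_cBall_sum (hm : 2 ≤ m) {o : CarpetV m} (ho : o.1 = fun _ => 0) (n : ℕ)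
    (x : CarpetV m) (hx : ∑ i, x.1 i = n) : x ∈ cBall o n := by
  induction n generalizing x with
  | zero =>
    have : x = o := by
      apply Subtype.ext
      rw [ho]
      funext i
      exact (Finset.sum_eq_zero_iff_of_nonneg fun j _ => x.2.1 j).1 (by simpa using hx) i
        (Finset.mem_univ i)
    rw [this]
    exact Set.mem_singleton o
  | succ n ih =>
    have hx0 : x.1 ≠ 0 := by
      intro h
      rw [h] at hx
      simp at hx
      omega
    obtain ⟨j, -, hj⟩ := exists_pred hm x.2 hx0
    set y : CarpetV m := ⟨x.1 - Pi.single j 1, hj⟩ with hy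
    refine Or.inr ⟨y, ih y ?_, ?_⟩
    · have : ∑ i, y.1 i = ∑ i, x.1 i - 1 := by
        simp [hy, Finset.sum_sub_distrib]
      rw [this, hx]
      push_cast
      ring
    · refine sum_abs_sub_eq_one (mem_cNbrs.2 ⟨j, Or.inl ?_⟩)
      simp [hy]

theorem mem_cBall_cDist (hm : 2 ≤ m) {o : CarpetV m} (ho : o.1 = fun _ => 0) (x : CarpetV m) :
    x ∈ cBall o (cDist o x) := by
  refine Nat.sInf_mem (s := {n : ℕ | x ∈ cBall o n}) ⟨(∑ i, x.1 i).toNat, ?_⟩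
  refine mem_cBall_sum hm ho _ x ?_
  have : 0 ≤ ∑ i, x.1 i := Finset.sum_nonneg fun i _ => x.2.1 i
  omega

theorem cDist_le_mul_supN (hm : 2 ≤ m) {o : CarpetV m} (ho : o.1 = fun _ => 0) (x : CarpetV m) :
    cDist o x ≤ m * supN x := by
  have h0 : 0 ≤ ∑ i, x.1 i := Finset.sum_nonneg fun i _ => x.2.1 i
  have h1 : cDist o x ≤ (∑ i, x.1 i).toNat :=
    Nat.sInf_le (mem_cBall_sum hm ho _ x (by omega))
  have h2 : ∑ i, x.1 i ≤ ∑ i : Fin m, (supN x : ℤ) := by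
    refine Finset.sum_le_sum fun i _ => ?_
    have := toNat_le_supN x i
    omega
  simp only [Finset.sum_const, Finset.card_univ, Fintype.card_fin, nsmul_eq_mul] at h2
  have h3 : (((∑ i, x.1 i).toNat : ℕ) : ℤ) ≤ ((m * supN x : ℕ) : ℤ) := by
    push_cast
    omega
  exact h1.trans (by exact_mod_cast h3)

theorem cDist_le_succ (hm : 2 ≤ m) {o : CarpetV m} (ho : o.1 = fun _ => 0) {x y : CarpetV m}
    (h : y ∈ cNbrs x) : cDist o y ≤ cDist o x + 1 :=
  Nat.sInf_le (Or.inr ⟨x, mem_cBall_cDist hm ho x, sum_abs_sub_eq_one h⟩)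

/-! ### Harmonic measure of the outer boundary of a cluster -/

theorem exists_harmonic_measure_bdry_le (hm : 3 ≤ m) {b γ : ℝ} (hb : 1 ≤ b) (hγ0 : 0 ≤ γ)
    (hγ1 : γ ≤ 1) (hbγ : 9 / (3 ^ m - 3) * b ^ γ < 1) :
    ∃ C : ℝ, 0 < C ∧ ∀ E A : Finset (CarpetV m), A ⊆ E → A.Nonempty →
      (∀ k z, (((A.filter fun x => blockIdx k x.1 = z).card : ℕ) : ℝ) ≤ b ^ k) →
      ∀ y ∈ bdryF cNbrs E, ∀ μ : ℝ,
        Tendsto (fun x => hitMeas cNbrs (↑(bdryF cNbrs E)) x y /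
          ∑ z ∈ bdryF cNbrs E, hitMeas cNbrs (↑(bdryF cNbrs E)) x z) cofinite (𝓝 μ) →
        μ ≤ C * (A.card : ℝ) ^ (-γ) := by
  classical
  obtain ⟨c, hc, hen⟩ := exists_energy_lower_bound hm hb hγ0 hγ1 hbγ
  have hm0 : (0 : ℝ) < m := by exact_mod_cast (by omega : 0 < m)
  refine ⟨4 * m / c, by positivity, ?_⟩
  intro E A hAE hAne hblock y hy μ hμ
  have hA0 : (0 : ℝ) < A.card := by exact_mod_cast hAne.card_pos
  have hs : ∀ x z : CarpetV m, z ∈ cNbrs x → x ∈ cNbrs z := fun _ _ => mem_cNbrs_symm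
  have hAγ : 0 < (A.card : ℝ) ^ γ := Real.rpow_pos_of_pos hA0 _
  have hcap : ∀ (B : Finset (CarpetV m)) (u : CarpetV m → ℝ), (∀ x ∈ bdryF cNbrs E, u x = 1) →
      (∀ x ∉ B, u x = 0) → c * (A.card : ℝ) ^ γ / 2 ≤ ∑ x ∈ B, u x * lapl cNbrs u x := by
    intro B u hu1 hu0
    set S := (B ∪ E) ∪ (B ∪ E).biUnion cNbrs with hS
    have hBS : B ⊆ S := Finset.subset_union_left.trans Finset.subset_union_left
    have hnS : ∀ x ∈ B, cNbrs x ⊆ S := fun x hx =>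
      (Finset.subset_biUnion_of_mem cNbrs (Finset.mem_union_left E hx)).trans
        Finset.subset_union_right
    have hen2 := sum_sq_sub_eq hs hu0 hBS hnS
    set v : CarpetV m → ℝ := fun x => if x ∈ E then 1 else u x with hv
    set f : (Fin m → ℤ) → ℝ := Function.extend CarpetV.pt v 0 with hf
    set e : CarpetV m → ℝ := fun x => ∑ w ∈ cNbrs x, (v x - v w) ^ 2 with he
    have hfv : ∀ x : CarpetV m, f x.pt = v x := fun x =>
      CarpetV.pt_injective.extend_apply v 0 x
    have hev : ∀ x : CarpetV m, Function.extend CarpetV.pt e 0 x.pt = e x := fun x =>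
      CarpetV.pt_injective.extend_apply e 0 x
    have hv0 : ∀ x ∉ B ∪ E, v x = 0 := by
      intro x hx
      rw [Finset.mem_union, not_or] at hx
      simp only [hv, if_neg hx.2, hu0 x hx.1]
    have hmain : c * (A.card : ℝ) ^ γ ≤ ∑ x ∈ S, e x := by
      have := hen (S.image CarpetV.pt) (A.image CarpetV.pt) (Function.extend CarpetV.pt e 0) f
        ?_ ?_ ?_ ?_ ?_ (hAne.image _)
      · rw [Finset.sum_image CarpetV.pt_injective.injOn,
          Finset.card_image_of_injective _ CarpetV.pt_injective] at this
        simpa only [hev] using this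
      · intro x
        by_cases hx : inCarpet m x
        · have := hev ⟨x, hx⟩
          change Function.extend CarpetV.pt e 0 x = _ at this
          rw [this]
          exact Finset.sum_nonneg fun _ _ => sq_nonneg _
        · rw [Function.extend_apply' _ _ _ (by rintro ⟨a, rfl⟩; exact hx a.2)]
          exact le_rfl
      · intro z i hz hz'
        set a : CarpetV m := ⟨z, hz⟩ with ha
        set a' : CarpetV m := ⟨z + Pi.single i 1, hz'⟩ with ha'
        have hadj : a' ∈ cNbrs a := mem_cNbrs.2 ⟨i, Or.inl rfl⟩
        have h1 : f (z + Pi.single i 1) = v a' := hfv a'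
        have h2 : f z = v a := hfv a
        have h3 : Function.extend CarpetV.pt e 0 z = e a := hev a
        rw [h1, h2, h3]
        by_cases haS : a ∈ S
        · have hzS : z ∈ S.image CarpetV.pt := Finset.mem_image.2 ⟨a, haS, rfl⟩
          rw [if_pos hzS]
          calc (v a' - v a) ^ 2 = (v a - v a') ^ 2 := by ring
            _ ≤ e a := Finset.single_le_sum (f := fun w => (v a - v w) ^ 2)
              (fun _ _ => sq_nonneg _) hadj
        · have hzS : z ∉ S.image CarpetV.pt := by
            intro h
            obtain ⟨x, hx, hxz⟩ := Finset.mem_image.1 h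
            exact haS (by rwa [← Subtype.ext (a2 := a) hxz])
          rw [if_neg hzS, hv0 a fun h => haS (Finset.mem_union_left _ h), hv0 a' fun h => haS
            (Finset.mem_union_right _ (Finset.mem_biUnion.2 ⟨a', h, hs _ _ hadj⟩))]
          norm_num
      · intro x hx
        obtain ⟨a, haA, rfl⟩ := Finset.mem_image.1 hx
        refine ⟨a.2, ?_⟩
        rw [hfv]
        exact if_pos (hAE haA)
      · refine ⟨S.sup supN, fun z hz i => ?_⟩
        by_cases hzc : inCarpet m z
        · set a : CarpetV m := ⟨z, hzc⟩ with ha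
          have haS : a ∈ S := by
            by_contra h
            refine hz ((hfv a).trans (hv0 a fun h' => h (Finset.mem_union_left _ h')))
          have h1 := toNat_le_supN a i
          have h2 : supN a ≤ S.sup supN := Finset.le_sup haS
          have h3 : S.sup supN < 3 ^ S.sup supN := Nat.lt_pow_self (by norm_num)
          have h4 : ((S.sup supN : ℕ) : ℤ) < 3 ^ S.sup supN := by exact_mod_cast h3
          have h5 : a.1 i = z i := rfl
          omega
        · exact absurd (Function.extend_apply' _ _ _ (by rintro ⟨a, rfl⟩; exact hzc a.2)) hz
      · intro k z
        rw [Finset.filter_image, Finset.card_image_of_injective _ CarpetV.pt_injective]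
        exact hblock k z
    have hle : ∑ x ∈ S, e x ≤ ∑ x ∈ S, ∑ z ∈ cNbrs x, (u x - u z) ^ 2 := by
      refine Finset.sum_le_sum fun x _ => Finset.sum_le_sum fun z hz => ?_
      have hb : ∀ x z : CarpetV m, z ∈ cNbrs x → x ∈ E → z ∉ E → u z = 1 := fun x z hz hx hzE =>
        hu1 z (Finset.mem_sdiff.2 ⟨Finset.mem_biUnion.2 ⟨x, hx, hz⟩, hzE⟩)
      by_cases hx : x ∈ E <;> by_cases hzE : z ∈ E
      · simp only [hv, if_pos hx, if_pos hzE, sub_self]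
        exact (zero_pow two_ne_zero).trans_le (sq_nonneg _)
      · simp only [hv, if_pos hx, if_neg hzE, hb x z hz hx hzE, sub_self]
        exact (zero_pow two_ne_zero).trans_le (sq_nonneg _)
      · simp only [hv, if_neg hx, if_pos hzE, hb z x (hs _ _ hz) hzE hx, sub_self]
        exact (zero_pow two_ne_zero).trans_le (sq_nonneg _)
      · simp only [hv, if_neg hx, if_neg hzE, le_refl]
    linarith
  refine (harmonic_measure_le hs (by positivity) hcap hy hμ).trans ?_
  have hdeg : ((cNbrs y).card : ℝ) ≤ 2 * m := by exact_mod_cast card_cNbrs_le y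
  rw [Real.rpow_neg hA0.le]
  calc ((cNbrs y).card : ℝ) / (c * (A.card : ℝ) ^ γ / 2) ≤ 2 * m / (c * (A.card : ℝ) ^ γ / 2) := by
        gcongr
    _ = _ := by field_simp; ring

/-! ### Counting points of blocks -/

theorem card_filter_blockIdx_le (A : Finset (CarpetV m)) (k : ℕ) (z : Fin m → ℤ) :
    (A.filter fun x => blockIdx k x.1 = z).card ≤ (3 ^ m) ^ k := by
  classical
  calc (A.filter fun x => blockIdx k x.1 = z).card
      ≤ (Fintype.piFinset fun i => Finset.Ico (3 ^ k * z i) (3 ^ k * z i + 3 ^ k)).card := by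
        refine Finset.card_le_card_of_injOn Subtype.val (fun x hx => ?_)
          Subtype.val_injective.injOn
        rw [Finset.mem_coe, Finset.mem_filter] at hx
        rw [Finset.mem_coe, Fintype.mem_piFinset]
        intro i
        have h := congrFun hx.2 i
        have hp : (0 : ℤ) < 3 ^ k := by positivity
        have h1 := Int.emod_nonneg (x.1 i) hp.ne'
        have h2 := Int.emod_lt_of_pos (x.1 i) hp
        have h3 := Int.mul_ediv_add_emod (x.1 i) (3 ^ k)
        simp only [blockIdx] at h
        rw [h] at h3
        rw [Finset.mem_Ico]
        constructor <;> linarith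
    _ = (3 ^ m) ^ k := by
        rw [Fintype.card_piFinset]
        have : ∀ i, (Finset.Ico (3 ^ k * z i) (3 ^ k * z i + 3 ^ k)).card = 3 ^ k := by
          intro i
          rw [Int.card_Ico, add_sub_cancel_left]
          exact_mod_cast Int.toNat_natCast (3 ^ k)
        simp only [this, Finset.prod_const, Finset.card_univ, Fintype.card_fin]
        rw [← pow_mul, ← pow_mul, mul_comm]

theorem supN_div (k : ℕ) (x : CarpetV m) :
    supN x / 3 ^ k = Finset.univ.sup fun i => (blockIdx k x.1 i).toNat := by
  rw [supN, Finset.apply_sup_eq_sup_comp_of_linearOrder (fun n => n / 3 ^ k)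
    (fun a b h => Nat.div_le_div_right h) (Nat.zero_div _)]
  refine Finset.sup_congr rfl fun i _ => ?_
  have h := x.2.1 i
  simp only [Function.comp, blockIdx]
  obtain ⟨n, hn⟩ := Int.eq_ofNat_of_zero_le h
  rw [hn]
  norm_cast

theorem card_filter_blockIdx_le_of_injOn {A : Finset (CarpetV m)}
    (hA : Set.InjOn supN (A : Set (CarpetV m))) (k : ℕ) (z : Fin m → ℤ) :
    (A.filter fun x => blockIdx k x.1 = z).card ≤ 3 ^ k := by
  set M := Finset.univ.sup fun i => (z i).toNat with hM
  calc (A.filter fun x => blockIdx k x.1 = z).card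
      ≤ (Finset.Ico (3 ^ k * M) (3 ^ k * M + 3 ^ k)).card := by
        refine Finset.card_le_card_of_injOn supN (fun x hx => ?_)
          (hA.mono (Finset.coe_subset.2 (Finset.filter_subset _ _)))
        rw [Finset.mem_coe, Finset.mem_filter] at hx
        have h : supN x / 3 ^ k = M := by rw [supN_div, hx.2]
        have h1 := Nat.mod_lt (supN x) (y := 3 ^ k) (by positivity)
        have h2 := Nat.div_add_mod (supN x) (3 ^ k)
        rw [h] at h2
        rw [Finset.mem_coe, Finset.mem_Ico]
        omega
    _ = 3 ^ k := by simp

end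

/-! ### Growth of randomly growing clusters -/

section
variable {V : Type*} [DecidableEq V] {nbr : V → Finset V}
  {Ω : Type*} [MeasurableSpace Ω] {P : Measure Ω}
  {E : ℕ → Ω → Finset V} {Y : ℕ → Ω → V} {μh : Finset V → V → ℝ}

theorem tsum_measure_succ_le [Countable V]
    (hstep : ∀ n ω, E (n + 1) ω = insert (Y (n + 1) ω) (E n ω))
    (hbd : ∀ n ω, Y (n + 1) ω ∈ bdryF nbr (E n ω))
    (hlaw : ∀ (n : ℕ) (A : Finset V), ∀ y ∈ bdryF nbr A, P {ω | E n ω = A ∧ Y (n + 1) ω = y} =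
      ENNReal.ofReal (μh (bdryF nbr A) y) * P {ω | E n ω = A}) (n : ℕ) (Φ : Finset V → ENNReal) :
    ∑' B, P {ω | E (n + 1) ω = B} * Φ B ≤ ∑' A, P {ω | E n ω = A} *
      ∑ y ∈ bdryF nbr A, ENNReal.ofReal (μh (bdryF nbr A) y) * Φ (insert y A) := by
  have h1 : ∀ B, P {ω | E (n + 1) ω = B} ≤ ∑' A, ∑ y ∈ bdryF nbr A,
      if B = insert y A then P {ω | E n ω = A ∧ Y (n + 1) ω = y} else 0 := by
    intro B
    have hsub : {ω | E (n + 1) ω = B} ⊆ ⋃ A, ⋃ y ∈ bdryF nbr A,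
        {ω | B = insert y A ∧ E n ω = A ∧ Y (n + 1) ω = y} := by
      intro ω hω
      simp only [Set.mem_iUnion]
      exact ⟨E n ω, Y (n + 1) ω, hbd n ω, by rw [← hstep, ← hω], rfl, rfl⟩
    refine (measure_mono hsub).trans ((measure_iUnion_le _).trans ?_)
    refine ENNReal.tsum_le_tsum fun A => (measure_biUnion_finset_le _ _).trans ?_
    refine Finset.sum_le_sum fun y _ => ?_
    split_ifs with h
    · exact measure_mono fun ω hω => hω.2
    · simp [h]
  calc ∑' B, P {ω | E (n + 1) ω = B} * Φ B
      ≤ ∑' B, (∑' A, ∑ y ∈ bdryF nbr A,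
          if B = insert y A then P {ω | E n ω = A ∧ Y (n + 1) ω = y} else 0) * Φ B := by
        gcongr with B
        exact h1 B
    _ = ∑' A, ∑' B, ∑ y ∈ bdryF nbr A,
          if B = insert y A then P {ω | E n ω = A ∧ Y (n + 1) ω = y} * Φ (insert y A) else 0 := by
        rw [ENNReal.tsum_comm]
        refine tsum_congr fun B => ?_
        rw [← ENNReal.tsum_mul_right]
        refine tsum_congr fun A => ?_
        rw [Finset.sum_mul]
        refine Finset.sum_congr rfl fun y _ => ?_
        split_ifs with h
        · rw [h]
        · rw [zero_mul]
    _ = _ := by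
        refine tsum_congr fun A => ?_
        rw [Summable.tsum_finsetSum fun _ _ => ENNReal.summable, Finset.mul_sum]
        refine Finset.sum_congr rfl fun y hy => ?_
        rw [tsum_ite_eq, hlaw n A y hy]
        ring

/-- The weight of a vertex at distance `d`, relative to the level `L`. -/
noncomputable def levelWt (L : ℝ) (d : ℕ) : ℝ := Real.exp (max 0 (d - L))

theorem one_le_levelWt (L : ℝ) (d : ℕ) : 1 ≤ levelWt L d := Real.one_le_exp (le_max_left _ _)

theorem levelWt_le {L : ℝ} {d d' : ℕ} (h : d' ≤ d + 1) :
    levelWt L d' ≤ Real.exp 1 * levelWt L d := by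
  have h' : (d' : ℝ) ≤ d + 1 := by exact_mod_cast h
  rw [levelWt, levelWt, ← Real.exp_add, Real.exp_le_exp]
  refine max_le (by linarith [le_max_left 0 ((d : ℝ) - L)]) ?_
  linarith [le_max_right 0 ((d : ℝ) - L)]

/-- The total weight of a cluster. -/
noncomputable def clusterWt (L : ℝ) (d : V → ℕ) (A : Finset V) : ℝ := ∑ x ∈ A, levelWt L (d x)

omit [DecidableEq V] in
theorem clusterWt_nonneg (L : ℝ) (d : V → ℕ) (A : Finset V) : 0 ≤ clusterWt L d A :=
  Finset.sum_nonneg fun _ _ => zero_le_one.trans (one_le_levelWt _ _)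

variable {d : V → ℕ} {D : ℕ}

theorem sum_bdryF_levelWt_le (hdeg : ∀ x, (nbr x).card ≤ D)
    (hd : ∀ x, ∀ y ∈ nbr x, d y ≤ d x + 1) (L : ℝ) (A : Finset V) :
    ∑ y ∈ bdryF nbr A, levelWt L (d y) ≤ D * Real.exp 1 * clusterWt L d A := by
  have hw : ∀ n, 0 ≤ levelWt L n := fun n => zero_le_one.trans (one_le_levelWt _ _)
  calc ∑ y ∈ bdryF nbr A, levelWt L (d y) ≤ ∑ y ∈ A.biUnion nbr, levelWt L (d y) :=
        Finset.sum_le_sum_of_subset_of_nonneg Finset.sdiff_subset fun _ _ _ => hw _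
    _ ≤ ∑ x ∈ A, ∑ y ∈ nbr x, levelWt L (d y) := by
        rw [← Finset.sum_sigma A nbr fun p => levelWt L (d p.2)]
        have : A.biUnion nbr = (A.sigma nbr).image fun p => p.2 := by
          ext y
          simp
        rw [this]
        exact Finset.sum_image_le_of_nonneg fun _ _ => hw _
    _ ≤ ∑ x ∈ A, D * Real.exp 1 * levelWt L (d x) := by
        refine Finset.sum_le_sum fun x _ => ?_
        calc ∑ y ∈ nbr x, levelWt L (d y) ≤ ∑ y ∈ nbr x, Real.exp 1 * levelWt L (d x) :=
              Finset.sum_le_sum fun y hy => levelWt_le (hd x y hy)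
          _ = (nbr x).card * (Real.exp 1 * levelWt L (d x)) := by
              rw [Finset.sum_const, nsmul_eq_mul]
          _ ≤ D * (Real.exp 1 * levelWt L (d x)) := by
              have := hw (d x)
              gcongr
              exact hdeg x
          _ = _ := by ring
    _ = _ := by rw [clusterWt, Finset.mul_sum]

/-- One step of the growth multiplies the expected weight of the cluster by a factor which is
controlled by the harmonic measure, up to an additive constant. -/
theorem sum_mul_clusterWt_insert_le (hdeg : ∀ x, (nbr x).card ≤ D)
    (hd : ∀ x, ∀ y ∈ nbr x, d y ≤ d x + 1) {L q : ℝ} {A : Finset V} {μ : V → ℝ} (hq : 0 ≤ q)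
    (hμ0 : ∀ y ∈ bdryF nbr A, 0 ≤ μ y) (hμ1 : ∑ y ∈ bdryF nbr A, μ y ≤ 1)
    (hμq : (∃ x ∈ A, L < d x) → ∀ y ∈ bdryF nbr A, μ y ≤ q) :
    ∑ y ∈ bdryF nbr A, μ y * clusterWt L d (insert y A) ≤
      (1 + D * Real.exp 1 * q) * clusterWt L d A + Real.exp 1 := by
  have hw : ∀ n, 0 ≤ levelWt L n := fun n => zero_le_one.trans (one_le_levelWt _ _)
  have hZ := clusterWt_nonneg L d A
  have hins : ∀ y ∈ bdryF nbr A, μ y * clusterWt L d (insert y A) =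
      μ y * clusterWt L d A + μ y * levelWt L (d y) := by
    intro y hy
    rw [clusterWt, Finset.sum_insert (Finset.mem_sdiff.1 hy).2, clusterWt]
    ring
  rw [Finset.sum_congr rfl hins, Finset.sum_add_distrib, ← Finset.sum_mul]
  have h1 : (∑ y ∈ bdryF nbr A, μ y) * clusterWt L d A ≤ 1 * clusterWt L d A := by gcongr
  have h2 : ∑ y ∈ bdryF nbr A, μ y * levelWt L (d y) ≤
      D * Real.exp 1 * q * clusterWt L d A + Real.exp 1 := by
    have hZq : 0 ≤ D * Real.exp 1 * q * clusterWt L d A := by positivity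
    by_cases hfar : ∃ x ∈ A, L < d x
    · have := Real.exp_pos 1
      calc ∑ y ∈ bdryF nbr A, μ y * levelWt L (d y)
          ≤ ∑ y ∈ bdryF nbr A, q * levelWt L (d y) :=
            Finset.sum_le_sum fun y hy => mul_le_mul_of_nonneg_right (hμq hfar y hy) (hw _)
        _ = q * ∑ y ∈ bdryF nbr A, levelWt L (d y) := by rw [Finset.mul_sum]
        _ ≤ q * (D * Real.exp 1 * clusterWt L d A) := by
            gcongr
            exact sum_bdryF_levelWt_le hdeg hd L A
        _ ≤ _ := by linarith
    · push Not at hfar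
      calc ∑ y ∈ bdryF nbr A, μ y * levelWt L (d y) ≤ ∑ y ∈ bdryF nbr A, μ y * Real.exp 1 := by
            refine Finset.sum_le_sum fun y hy => mul_le_mul_of_nonneg_left ?_ (hμ0 y hy)
            obtain ⟨x, hx, hxy⟩ := Finset.mem_biUnion.1 (Finset.mem_sdiff.1 hy).1
            have h := levelWt_le (L := L) (hd x y hxy)
            have h' : levelWt L (d x) = 1 := by
              rw [levelWt, max_eq_left (by linarith [hfar x hx]), Real.exp_zero]
            rwa [h', mul_one] at h
        _ = (∑ y ∈ bdryF nbr A, μ y) * Real.exp 1 := by rw [Finset.sum_mul]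
        _ ≤ 1 * Real.exp 1 := by gcongr
        _ ≤ _ := by linarith
  linarith

variable [Countable V] [IsProbabilityMeasure P] {o : V}

theorem tsum_measure_eq_le_one (h0 : ∀ ω, E 0 ω = {o})
    (hstep : ∀ n ω, E (n + 1) ω = insert (Y (n + 1) ω) (E n ω))
    (hbd : ∀ n ω, Y (n + 1) ω ∈ bdryF nbr (E n ω))
    (hlaw : ∀ (n : ℕ) (A : Finset V), ∀ y ∈ bdryF nbr A, P {ω | E n ω = A ∧ Y (n + 1) ω = y} =
      ENNReal.ofReal (μh (bdryF nbr A) y) * P {ω | E n ω = A})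
    (hμ0 : ∀ A, ∀ y ∈ bdryF nbr A, 0 ≤ μh (bdryF nbr A) y)
    (hμ1 : ∀ A, ∑ y ∈ bdryF nbr A, μh (bdryF nbr A) y ≤ 1) (n : ℕ) :
    ∑' A, P {ω | E n ω = A} ≤ 1 := by
  induction n with
  | zero =>
    have : ∀ A, P {ω | E 0 ω = A} = if A = {o} then 1 else 0 := by
      intro A
      simp only [h0]
      split_ifs with h
      · simp [h]
      · simp [Ne.symm h]
    simp only [this]
    rw [tsum_ite_eq]
  | succ n ih =>
    have h := tsum_measure_succ_le hstep hbd hlaw n fun _ => 1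
    simp only [mul_one] at h
    refine h.trans (le_trans ?_ ih)
    refine ENNReal.tsum_le_tsum fun A => mul_le_of_le_one_right' ?_
    rw [← ENNReal.ofReal_sum_of_nonneg (hμ0 A)]
    exact ENNReal.ofReal_le_one.2 (hμ1 A)

theorem tsum_measure_mul_clusterWt_le (hdeg : ∀ x, (nbr x).card ≤ D)
    (hd : ∀ x, ∀ y ∈ nbr x, d y ≤ d x + 1) (hdo : d o = 0) (h0 : ∀ ω, E 0 ω = {o})
    (hstep : ∀ n ω, E (n + 1) ω = insert (Y (n + 1) ω) (E n ω))
    (hbd : ∀ n ω, Y (n + 1) ω ∈ bdryF nbr (E n ω))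
    (hlaw : ∀ (n : ℕ) (A : Finset V), ∀ y ∈ bdryF nbr A, P {ω | E n ω = A ∧ Y (n + 1) ω = y} =
      ENNReal.ofReal (μh (bdryF nbr A) y) * P {ω | E n ω = A})
    (hμ0 : ∀ A, ∀ y ∈ bdryF nbr A, 0 ≤ μh (bdryF nbr A) y)
    (hμ1 : ∀ A, ∑ y ∈ bdryF nbr A, μh (bdryF nbr A) y ≤ 1) {L : ℝ} (hL : 0 ≤ L) {q : ℕ → ℝ}
    (hq : ∀ n, 0 ≤ q n) {N : ℕ}
    (hμq : ∀ n < N, ∀ ω, (∃ x ∈ E n ω, L < d x) →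
      ∀ y ∈ bdryF nbr (E n ω), μh (bdryF nbr (E n ω)) y ≤ q n) {n : ℕ} (hn : n ≤ N) :
    ∑' A, P {ω | E n ω = A} * ENNReal.ofReal (clusterWt L d A) ≤ ENNReal.ofReal
      ((1 + Real.exp 1 * n) * Real.exp (D * Real.exp 1 * ∑ i ∈ Finset.range n, q i)) := by
  induction n with
  | zero =>
    have : ∀ A, P {ω | E 0 ω = A} * ENNReal.ofReal (clusterWt L d A) =
        if A = {o} then 1 else 0 := by
      intro A
      simp only [h0]
      split_ifs with h
      · simp [h, clusterWt, levelWt, hdo, hL]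
      · simp [Ne.symm h]
    simp only [this]
    rw [tsum_ite_eq]
    simp
  | succ n ih =>
    set κ := D * Real.exp 1 with hκ
    have hκ0 : 0 ≤ κ := by positivity
    set s := ∑ i ∈ Finset.range n, q i with hs
    have hs0 : 0 ≤ s := Finset.sum_nonneg fun _ _ => hq _
    have hfac : 0 ≤ 1 + κ * q n := by have := hq n; positivity
    have hA : ∀ A, P {ω | E n ω = A} * ∑ y ∈ bdryF nbr A, ENNReal.ofReal (μh (bdryF nbr A) y) *
        ENNReal.ofReal (clusterWt L d (insert y A)) ≤ ENNReal.ofReal (1 + κ * q n) *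
          (P {ω | E n ω = A} * ENNReal.ofReal (clusterWt L d A)) +
            ENNReal.ofReal (Real.exp 1) * P {ω | E n ω = A} := by
      intro A
      by_cases hre : ∃ ω, E n ω = A
      · obtain ⟨ω, rfl⟩ := hre
        have h := sum_mul_clusterWt_insert_le hdeg hd (hq n) (hμ0 (E n ω)) (hμ1 (E n ω))
          (hμq n (by omega) ω)
        have hsum : ∑ y ∈ bdryF nbr (E n ω), ENNReal.ofReal (μh (bdryF nbr (E n ω)) y) *
            ENNReal.ofReal (clusterWt L d (insert y (E n ω))) =
            ENNReal.ofReal (∑ y ∈ bdryF nbr (E n ω), μh (bdryF nbr (E n ω)) y *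
              clusterWt L d (insert y (E n ω))) := by
          rw [ENNReal.ofReal_sum_of_nonneg fun y hy =>
            mul_nonneg (hμ0 _ y hy) (clusterWt_nonneg _ _ _)]
          exact Finset.sum_congr rfl fun y hy => (ENNReal.ofReal_mul (hμ0 _ y hy)).symm
        rw [hsum]
        calc _ ≤ P {ω' | E n ω' = E n ω} * ENNReal.ofReal
              ((1 + κ * q n) * clusterWt L d (E n ω) + Real.exp 1) := by gcongr
          _ = _ := by
            rw [ENNReal.ofReal_add (mul_nonneg hfac (clusterWt_nonneg _ _ _)) (Real.exp_pos 1).le,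
              ENNReal.ofReal_mul hfac]
            ring
      · have : {ω | E n ω = A} = ∅ := by
          ext ω
          simpa using fun h => hre ⟨ω, h⟩
        simp [this]
    refine (tsum_measure_succ_le hstep hbd hlaw n _).trans
      ((ENNReal.tsum_le_tsum hA).trans ?_)
    rw [ENNReal.tsum_add, ENNReal.tsum_mul_left, ENNReal.tsum_mul_left]
    have hB : 0 ≤ (1 + Real.exp 1 * n) * Real.exp (κ * s) := by positivity
    calc _ ≤ ENNReal.ofReal (1 + κ * q n) *
          ENNReal.ofReal ((1 + Real.exp 1 * n) * Real.exp (κ * s)) +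
            ENNReal.ofReal (Real.exp 1) * 1 := by
          gcongr
          · exact ih (by omega)
          · exact tsum_measure_eq_le_one h0 hstep hbd hlaw hμ0 hμ1 n
      _ = ENNReal.ofReal ((1 + κ * q n) * ((1 + Real.exp 1 * n) * Real.exp (κ * s)) +
            Real.exp 1) := by
          rw [ENNReal.ofReal_add (mul_nonneg hfac hB) (Real.exp_pos 1).le,
            ENNReal.ofReal_mul hfac, mul_one]
      _ ≤ _ := by
          refine ENNReal.ofReal_le_ofReal ?_
          rw [Finset.sum_range_succ, ← hs, mul_add, Real.exp_add]
          have h1 : 1 + κ * q n ≤ Real.exp (κ * q n) := by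
            linarith [Real.add_one_le_exp (κ * q n)]
          have h2 : 1 ≤ Real.exp (κ * s) * Real.exp (κ * q n) := by
            rw [← Real.exp_add]
            have := hq n
            exact Real.one_le_exp (by positivity)
          have h3 := mul_le_mul_of_nonneg_right h1 hB
          have h4 := mul_le_mul_of_nonneg_left h2 (Real.exp_pos 1).le
          push_cast
          linarith

theorem measure_exists_far_le (hdeg : ∀ x, (nbr x).card ≤ D)
    (hd : ∀ x, ∀ y ∈ nbr x, d y ≤ d x + 1) (hdo : d o = 0) (h0 : ∀ ω, E 0 ω = {o})
    (hstep : ∀ n ω, E (n + 1) ω = insert (Y (n + 1) ω) (E n ω))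
    (hbd : ∀ n ω, Y (n + 1) ω ∈ bdryF nbr (E n ω))
    (hlaw : ∀ (n : ℕ) (A : Finset V), ∀ y ∈ bdryF nbr A, P {ω | E n ω = A ∧ Y (n + 1) ω = y} =
      ENNReal.ofReal (μh (bdryF nbr A) y) * P {ω | E n ω = A})
    (hμ0 : ∀ A, ∀ y ∈ bdryF nbr A, 0 ≤ μh (bdryF nbr A) y)
    (hμ1 : ∀ A, ∑ y ∈ bdryF nbr A, μh (bdryF nbr A) y ≤ 1) {L : ℝ} (hL : 0 ≤ L) {q : ℕ → ℝ}
    (hq : ∀ n, 0 ≤ q n) {N : ℕ}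
    (hμq : ∀ n < N, ∀ ω, (∃ x ∈ E n ω, L < d x) →
      ∀ y ∈ bdryF nbr (E n ω), μh (bdryF nbr (E n ω)) y ≤ q n) (a : ℝ) :
    P {ω | ∃ x ∈ E N ω, L + a < d x} ≤ ENNReal.ofReal ((1 + Real.exp 1 * N) *
      Real.exp (D * Real.exp 1 * ∑ i ∈ Finset.range N, q i - a)) := by
  have hsub : {ω | ∃ x ∈ E N ω, L + a < d x} ⊆
      ⋃ A, {ω | E N ω = A ∧ ∃ x ∈ A, L + a < d x} := by
    intro ω hω
    exact Set.mem_iUnion.2 ⟨E N ω, rfl, hω⟩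
  refine (measure_mono hsub).trans ((measure_iUnion_le _).trans ?_)
  calc ∑' A, P {ω | E N ω = A ∧ ∃ x ∈ A, L + a < d x}
      ≤ ∑' A, ENNReal.ofReal (Real.exp (-a)) *
          (P {ω | E N ω = A} * ENNReal.ofReal (clusterWt L d A)) := by
        refine ENNReal.tsum_le_tsum fun A => ?_
        by_cases hA : ∃ x ∈ A, L + a < d x
        · obtain ⟨x, hx, hxa⟩ := hA
          have hZ : 1 ≤ Real.exp (-a) * clusterWt L d A := by
            calc (1 : ℝ) = Real.exp (-a) * Real.exp a := by rw [← Real.exp_add]; simp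
              _ ≤ Real.exp (-a) * levelWt L (d x) := by
                rw [levelWt]
                gcongr
                exact le_max_of_le_right (by linarith)
              _ ≤ _ := by
                gcongr
                exact Finset.single_le_sum (f := fun x => levelWt L (d x))
                  (fun _ _ => zero_le_one.trans (one_le_levelWt _ _)) hx
          calc P {ω | E N ω = A ∧ ∃ x ∈ A, L + a < d x} ≤ P {ω | E N ω = A} * 1 := by
                rw [mul_one]
                exact measure_mono fun ω hω => hω.1
            _ ≤ P {ω | E N ω = A} * ENNReal.ofReal (Real.exp (-a) * clusterWt L d A) := by
                gcongr
                exact ENNReal.one_le_ofReal.2 hZ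
            _ = _ := by
                rw [ENNReal.ofReal_mul (Real.exp_pos _).le]
                ring
        · simp [hA]
    _ ≤ ENNReal.ofReal (Real.exp (-a)) * ENNReal.ofReal ((1 + Real.exp 1 * N) *
          Real.exp (D * Real.exp 1 * ∑ i ∈ Finset.range N, q i)) := by
        rw [ENNReal.tsum_mul_left]
        gcongr
        exact tsum_measure_mul_clusterWt_le hdeg hd hdo h0 hstep hbd hlaw hμ0 hμ1 hL hq hμq le_rfl
    _ = _ := by
        rw [← ENNReal.ofReal_mul (Real.exp_pos _).le, sub_eq_add_neg, Real.exp_add]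
        congr 1
        ring

theorem summable_mul_exp_neg_rpow {β : ℝ} (hβ : 0 < β) (c : ℝ) :
    Summable fun N : ℕ => (1 + c * N) * Real.exp (-(N : ℝ) ^ β) := by
  have hb : (fun N : ℕ => Real.exp (-(N : ℝ) ^ β)) =O[atTop] fun N : ℕ => (N : ℝ) ^ (-3 : ℝ) := by
    have h := (isLittleO_exp_neg_mul_rpow_atTop one_pos (-3 / β)).isBigO.comp_tendsto
      ((tendsto_rpow_atTop hβ).comp tendsto_natCast_atTop_atTop)
    refine h.congr (fun N => ?_) fun N => ?_
    · simp
    · simp only [Function.comp]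
      rw [← Real.rpow_mul (Nat.cast_nonneg N), mul_div_cancel₀ _ hβ.ne']
  have hl : (fun N : ℕ => 1 + c * (N : ℝ)) =O[atTop] fun N : ℕ => (N : ℝ) := by
    refine Asymptotics.IsBigO.add ?_ ((Asymptotics.isBigO_refl _ _).const_mul_left c)
    refine Asymptotics.IsBigO.of_bound 1 ?_
    filter_upwards [eventually_ge_atTop 1] with N hN
    have : (1 : ℝ) ≤ N := by exact_mod_cast hN
    simpa using this
  refine summable_of_isBigO_nat (Real.summable_nat_rpow.2 (by norm_num : (-2 : ℝ) < -1))
    ((hl.mul hb).trans (Asymptotics.IsBigO.of_bound 1 ?_))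
  filter_upwards [eventually_ge_atTop 1] with N hN
  have hN0 : (0 : ℝ) < N := by exact_mod_cast hN
  have : (N : ℝ) * (N : ℝ) ^ (-3 : ℝ) = (N : ℝ) ^ (-2 : ℝ) := by
    rw [mul_comm, ← Real.rpow_add_one hN0.ne']
    norm_num
  rw [this, one_mul]

/-- If the harmonic measures are small enough on clusters of large radius, then the radius of the
cluster grows at most like `n ^ β`. -/
theorem ae_eventually_dist_le (hdeg : ∀ x, (nbr x).card ≤ D)
    (hd : ∀ x, ∀ y ∈ nbr x, d y ≤ d x + 1) (hdo : d o = 0) (h0 : ∀ ω, E 0 ω = {o})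
    (hstep : ∀ n ω, E (n + 1) ω = insert (Y (n + 1) ω) (E n ω))
    (hbd : ∀ n ω, Y (n + 1) ω ∈ bdryF nbr (E n ω))
    (hlaw : ∀ (n : ℕ) (A : Finset V), ∀ y ∈ bdryF nbr A, P {ω | E n ω = A ∧ Y (n + 1) ω = y} =
      ENNReal.ofReal (μh (bdryF nbr A) y) * P {ω | E n ω = A})
    (hμ0 : ∀ A, ∀ y ∈ bdryF nbr A, 0 ≤ μh (bdryF nbr A) y)
    (hμ1 : ∀ A, ∑ y ∈ bdryF nbr A, μh (bdryF nbr A) y ≤ 1) {β C : ℝ} (hβ : 0 < β)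
    {q : ℕ → ℕ → ℝ} (hq : ∀ N n, 0 ≤ q N n)
    (hqs : ∀ N : ℕ, ∑ n ∈ Finset.range N, q N n ≤ C * (N : ℝ) ^ β)
    (hμq : ∀ N, ∀ n < N, ∀ ω, (∃ x ∈ E n ω, (N : ℝ) ^ β < d x) →
      ∀ y ∈ bdryF nbr (E n ω), μh (bdryF nbr (E n ω)) y ≤ q N n) :
    ∃ K : ℝ, 0 ≤ K ∧ ∀ᵐ ω ∂P, ∀ᶠ N : ℕ in atTop, ∀ x ∈ E N ω, (d x : ℝ) ≤ K * (N : ℝ) ^ β := by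
  set κ := D * Real.exp 1 with hκ
  have hκ0 : 0 ≤ κ := by positivity
  have hC : 0 ≤ C := by
    have := (Finset.sum_nonneg fun n _ => hq 1 n).trans (hqs 1)
    simpa using this
  refine ⟨κ * C + 2, by positivity, ?_⟩
  have hsum : ∑' N : ℕ, P {ω | ∃ x ∈ E N ω, (N : ℝ) ^ β + (κ * C + 1) * (N : ℝ) ^ β < d x} ≠ ⊤ := by
    refine ne_top_of_le_ne_top
      (summable_mul_exp_neg_rpow hβ (Real.exp 1)).tsum_ofReal_ne_top (ENNReal.tsum_le_tsum ?_)
    intro N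
    refine (measure_exists_far_le hdeg hd hdo h0 hstep hbd hlaw hμ0 hμ1 (by positivity) (hq N)
      (hμq N) _).trans (ENNReal.ofReal_le_ofReal ?_)
    gcongr
    have := mul_le_mul_of_nonneg_left (hqs N) hκ0
    linarith
  filter_upwards [ae_eventually_notMem hsum] with ω hω
  filter_upwards [hω] with N hN x hx
  by_contra! h
  exact hN ⟨x, hx, by linarith⟩

end

/-! ### Growth of external DLA on the carpet graph -/

section
variable {m : ℕ}

theorem infinite_carpetV (hm : 2 ≤ m) : Infinite (CarpetV m) := by
  set i₀ : Fin m := ⟨0, by omega⟩ with hi₀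
  set i₁ : Fin m := ⟨1, by omega⟩ with hi₁
  have hne : i₁ ≠ i₀ := by simp [hi₀, hi₁]
  have hc : ∀ n : ℕ, inCarpet m (Pi.single i₀ (n : ℤ)) := by
    intro n
    refine ⟨fun i => ?_, fun k h => ?_⟩
    · rw [Pi.single_apply]
      split_ifs <;> positivity
    · have := h i₁
      simp [Pi.single_eq_of_ne hne] at this
  refine Infinite.of_injective (fun n : ℕ => (⟨Pi.single i₀ (n : ℤ), hc n⟩ : CarpetV m)) ?_
  intro a b h
  have := congrFun (congrArg Subtype.val h) i₀
  simpa using this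

section
variable {μh : Finset (CarpetV m) → CarpetV m → ℝ}
  (hμ : ∀ A : Finset (CarpetV m), A.Nonempty → ∀ y ∈ A,
    Tendsto (fun x => hitMeas cNbrs (↑A) x y / ∑ z ∈ A, hitMeas cNbrs (↑A) x z)
      cofinite (𝓝 (μh A y)))
include hμ

theorem harmonic_measure_nonneg (hm : 2 ≤ m) {A : Finset (CarpetV m)} {y : CarpetV m}
    (hy : y ∈ A) : 0 ≤ μh A y := by
  have := infinite_carpetV hm
  exact ge_of_tendsto' (hμ A ⟨y, hy⟩ y hy) fun x =>
    div_nonneg (hitMeas_nonneg _ _) (Finset.sum_nonneg fun _ _ => hitMeas_nonneg _ _)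

theorem sum_harmonic_measure_le_one (hm : 2 ≤ m) (A : Finset (CarpetV m)) :
    ∑ y ∈ A, μh A y ≤ 1 := by
  have := infinite_carpetV hm
  refine le_of_tendsto' (tendsto_finsetSum A fun y hy => hμ A ⟨y, hy⟩ y hy) fun x => ?_
  rw [← Finset.sum_div]
  exact div_self_le_one _

end

section
variable {o : CarpetV m} {Ω : Type*} {E : ℕ → Ω → Finset (CarpetV m)} {Y : ℕ → Ω → CarpetV m}
  (h0 : ∀ ω, E 0 ω = {o}) (hstep : ∀ n ω, E (n + 1) ω = insert (Y (n + 1) ω) (E n ω))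
  (hbd : ∀ n ω, Y (n + 1) ω ∈ bdryF cNbrs (E n ω))
include h0 hstep hbd

theorem card_cluster (n : ℕ) (ω : Ω) : (E n ω).card = n + 1 := by
  induction n with
  | zero => rw [h0, Finset.card_singleton]
  | succ n ih => rw [hstep, Finset.card_insert_of_notMem (Finset.mem_sdiff.1 (hbd n ω)).2, ih]

theorem exists_supN_eq (ho : o.1 = fun _ => 0) (n : ℕ) (ω : Ω) :
    ∀ x ∈ E n ω, ∀ k ≤ supN x, ∃ x' ∈ E n ω, supN x' = k := by
  induction n with
  | zero =>
    intro x hx k hk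
    rw [h0] at hx ⊢
    rw [Finset.mem_singleton] at hx
    have hN : supN o = 0 := by
      rw [supN, ho]
      exact Nat.le_zero.1 (Finset.sup_le fun _ _ => le_rfl)
    refine ⟨o, Finset.mem_singleton_self o, ?_⟩
    rw [hx] at hk
    omega
  | succ n ih =>
    have hY := hbd n ω
    intro x hx k hk
    rw [hstep] at hx ⊢
    have hold : ∀ x ∈ E n ω, k ≤ supN x → ∃ x' ∈ insert (Y (n + 1) ω) (E n ω), supN x' = k := by
      intro x hx hk
      obtain ⟨x', hx', h⟩ := ih x hx k hk
      exact ⟨x', Finset.mem_insert_of_mem hx', h⟩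
    rcases Finset.mem_insert.1 hx with rfl | hx
    · obtain ⟨z, hz, hzY⟩ := Finset.mem_biUnion.1 (Finset.mem_sdiff.1 hY).1
      have := supN_le_succ hzY
      rcases Nat.lt_or_ge (supN z) k with h | h
      · exact ⟨_, Finset.mem_insert_self _ _, by omega⟩
      · exact hold z hz h
    · exact hold x hx hk

end

variable (hm : 3 ≤ m) {o : CarpetV m} (ho : o.1 = fun _ => 0)
  {Ω : Type*} [MeasurableSpace Ω] {P : Measure Ω} [IsProbabilityMeasure P]
  {E : ℕ → Ω → Finset (CarpetV m)} {Y : ℕ → Ω → CarpetV m}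
  {μh : Finset (CarpetV m) → CarpetV m → ℝ}
  (hμ : ∀ A : Finset (CarpetV m), A.Nonempty → ∀ y ∈ A,
    Tendsto (fun x => hitMeas cNbrs (↑A) x y / ∑ z ∈ A, hitMeas cNbrs (↑A) x z)
      cofinite (𝓝 (μh A y)))
  (h0 : ∀ ω, E 0 ω = {o}) (hstep : ∀ n ω, E (n + 1) ω = insert (Y (n + 1) ω) (E n ω))
  (hbd : ∀ n ω, Y (n + 1) ω ∈ bdryF cNbrs (E n ω))
  (hlaw : ∀ (n : ℕ) (A : Finset (CarpetV m)), ∀ y ∈ bdryF cNbrs A,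
    P {ω | E n ω = A ∧ Y (n + 1) ω = y} =
      ENNReal.ofReal (μh (bdryF cNbrs A) y) * P {ω | E n ω = A})
include hm ho hμ h0 hstep hbd hlaw

theorem ae_eventually_radC_le {β C : ℝ} (hβ : 0 < β) {q : ℕ → ℕ → ℝ} (hq : ∀ N n, 0 ≤ q N n)
    (hqs : ∀ N : ℕ, ∑ n ∈ Finset.range N, q N n ≤ C * (N : ℝ) ^ β)
    (hμq : ∀ N, ∀ n < N, ∀ ω, (∃ x ∈ E n ω, (N : ℝ) ^ β < cDist o x) →
      ∀ y ∈ bdryF cNbrs (E n ω), μh (bdryF cNbrs (E n ω)) y ≤ q N n) :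
    ∃ K : ℝ, 0 ≤ K ∧ ∀ᵐ ω ∂P, ∀ᶠ N : ℕ in atTop, radC o (E N ω) ≤ K * (N : ℝ) ^ β := by
  have hdo : cDist o o = 0 := Nat.le_zero.1 (Nat.sInf_le (Set.mem_singleton o))
  obtain ⟨K, hK, h⟩ := ae_eventually_dist_le (d := cDist o) card_cNbrs_le
    (fun x y hy => cDist_le_succ (by omega) ho hy) hdo h0 hstep hbd hlaw
    (fun A y hy => harmonic_measure_nonneg hμ (by omega) hy)
    (fun A => sum_harmonic_measure_le_one hμ (by omega) _) hβ hq hqs hμq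
  refine ⟨K, hK, ?_⟩
  filter_upwards [h] with ω hω
  filter_upwards [hω] with N hN
  have hnn : 0 ≤ K * (N : ℝ) ^ β := by positivity
  exact Real.iSup_le (fun x => Real.iSup_le (fun hx => hN x hx) hnn) hnn

/-- The growth bound which follows from the capacity of the arms of the cluster. -/
theorem ae_eventually_radC_le_of_arms {γ : ℝ} (hγ0 : 0 ≤ γ) (hγ1 : γ ≤ 1)
    (hγ : 9 / (3 ^ m - 3) * (3 : ℝ) ^ γ < 1) :
    ∃ K : ℝ, 0 ≤ K ∧ ∀ᵐ ω ∂P, ∀ᶠ N : ℕ in atTop,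
      radC o (E N ω) ≤ K * (N : ℝ) ^ (1 / (1 + γ)) := by
  obtain ⟨C, hC, hle⟩ := exists_harmonic_measure_bdry_le hm (by norm_num) hγ0 hγ1 hγ
  have hm0 : (0 : ℝ) < m := by exact_mod_cast (by omega : 0 < m)
  set β := 1 / (1 + γ) with hβ
  have hβ0 : 0 < β := by positivity
  refine ae_eventually_radC_le hm ho hμ h0 hstep hbd hlaw (C := C * (m : ℝ) ^ γ) hβ0
    (q := fun N _ => C * ((N : ℝ) ^ β / m) ^ (-γ)) (fun N n => by positivity) (fun N => ?_) ?_
  · rw [Finset.sum_const, Finset.card_range, nsmul_eq_mul]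
    rcases Nat.eq_zero_or_pos N with rfl | hN
    · simp [hβ0.ne']
    have hN0 : (0 : ℝ) < N := by exact_mod_cast hN
    have h1 : ((N : ℝ) ^ β / m) ^ (-γ) = (N : ℝ) ^ (β * -γ) * (m : ℝ) ^ γ := by
      rw [Real.div_rpow (by positivity) hm0.le, ← Real.rpow_mul hN0.le, Real.rpow_neg hm0.le,
        div_inv_eq_mul]
    have h2 : (N : ℝ) * (N : ℝ) ^ (β * -γ) = (N : ℝ) ^ β := by
      rw [mul_comm, ← Real.rpow_add_one hN0.ne']
      congr 1
      rw [hβ]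
      field_simp
      ring
    rw [h1, ← h2]
    apply le_of_eq
    ring
  · rintro N n hn ω ⟨x, hx, hxL⟩ y hy
    have harm := exists_supN_eq h0 hstep hbd ho n ω x hx
    have : Nonempty (CarpetV m) := ⟨o⟩
    choose! f hfE hf using harm
    classical
    set A := (Finset.range (supN x + 1)).image f with hA
    have hf' : ∀ k ∈ Finset.range (supN x + 1), supN (f k) = k := fun k hk =>
      hf k (by rw [Finset.mem_range] at hk; omega)
    have hinj : Set.InjOn supN (A : Set (CarpetV m)) := by
      intro a ha b hb hab
      obtain ⟨i, hi, rfl⟩ := Finset.mem_image.1 (Finset.mem_coe.1 ha)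
      obtain ⟨j, hj, rfl⟩ := Finset.mem_image.1 (Finset.mem_coe.1 hb)
      rw [hf' i hi, hf' j hj] at hab
      rw [hab]
    have hcard : A.card = supN x + 1 := by
      rw [hA, Finset.card_image_of_injOn, Finset.card_range]
      intro i hi j hj hij
      rw [← hf' i hi, ← hf' j hj, hij]
    have hAE : A ⊆ E n ω := by
      intro a ha
      obtain ⟨i, hi, rfl⟩ := Finset.mem_image.1 ha
      exact hfE i (by rw [Finset.mem_range] at hi; omega)
    have hN0 : (0 : ℝ) < N := by exact_mod_cast (by omega : 0 < N)
    refine (hle (E n ω) A hAE (Finset.card_pos.1 (by omega)) (fun k z => ?_) y hy _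
      (hμ _ ⟨y, hy⟩ y hy)).trans ?_
    · exact_mod_cast card_filter_blockIdx_le_of_injOn hinj k z
    · refine mul_le_mul_of_nonneg_left ?_ hC.le
      refine Real.rpow_le_rpow_of_nonpos (by positivity) ?_ (by linarith)
      rw [div_le_iff₀ hm0, hcard]
      have h1 : (cDist o x : ℝ) ≤ m * supN x := by
        exact_mod_cast cDist_le_mul_supN (by omega) ho x
      push_cast
      linarith

/-- The growth bound which follows from the capacity of a set of given cardinality. -/
theorem ae_eventually_radC_le_of_card {γ : ℝ} (hγ0 : 0 ≤ γ) (hγ1 : γ < 1)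
    (hγ : 9 / (3 ^ m - 3) * ((3 : ℝ) ^ m) ^ γ < 1) :
    ∃ K : ℝ, 0 ≤ K ∧ ∀ᵐ ω ∂P, ∀ᶠ N : ℕ in atTop,
      radC o (E N ω) ≤ K * (N : ℝ) ^ (1 - γ) := by
  obtain ⟨C, hC, hle⟩ := exists_harmonic_measure_bdry_le hm
    (one_le_pow₀ (by norm_num : (1 : ℝ) ≤ 3)) hγ0 hγ1.le hγ
  have hβ : 0 < 1 - γ := by linarith
  refine ae_eventually_radC_le hm ho hμ h0 hstep hbd hlaw (C := C / (1 - γ)) hβ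
    (q := fun _ n => C * ((n : ℝ) + 1) ^ (-γ)) (fun N n => by positivity) (fun N => ?_) ?_
  · induction N with
    | zero => simp [hβ.ne']
    | succ n ih =>
      rw [Finset.sum_range_succ]
      have hn : (0 : ℝ) < (n : ℝ) + 1 := by positivity
      have hber : (n : ℝ) ^ (1 - γ) ≤ ((n : ℝ) + 1) ^ (1 - γ) - (1 - γ) * ((n : ℝ) + 1) ^ (-γ) := by
        have h1 : (n : ℝ) = (n + 1) * (1 + -((n : ℝ) + 1)⁻¹) := by field_simp; ring
        have h2 : ((n : ℝ) + 1)⁻¹ ≤ 1 :=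
          inv_le_one_of_one_le₀ (by linarith [n.cast_nonneg (α := ℝ)])
        have h3 := rpow_one_add_le_one_add_mul_self (s := -((n : ℝ) + 1)⁻¹) (by linarith)
          hβ.le (by linarith)
        have h4 : ((n : ℝ) + 1) ^ (-γ) = ((n : ℝ) + 1) ^ (1 - γ) * ((n : ℝ) + 1)⁻¹ := by
          rw [← Real.rpow_neg_one, ← Real.rpow_add hn]
          congr 1
          ring
        have h5 : (n : ℝ) ^ (1 - γ) =
            ((n : ℝ) + 1) ^ (1 - γ) * (1 + -((n : ℝ) + 1)⁻¹) ^ (1 - γ) := by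
          rw [← Real.mul_rpow hn.le (by linarith), ← h1]
        rw [h5, h4]
        calc _ ≤ ((n : ℝ) + 1) ^ (1 - γ) * (1 + (1 - γ) * -((n : ℝ) + 1)⁻¹) := by gcongr
          _ = _ := by ring
      have h6 := mul_le_mul_of_nonneg_left hber (by positivity : 0 ≤ C / (1 - γ))
      have h7 : C / (1 - γ) * (((n : ℝ) + 1) ^ (1 - γ) - (1 - γ) * ((n : ℝ) + 1) ^ (-γ)) =
          C / (1 - γ) * ((n : ℝ) + 1) ^ (1 - γ) - C * ((n : ℝ) + 1) ^ (-γ) := by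
        field_simp
      push_cast
      linarith
  · intro N n _ ω _ y hy
    have hcard := card_cluster h0 hstep hbd n ω
    refine (hle (E n ω) (E n ω) Finset.Subset.rfl (Finset.card_pos.1 (by omega)) (fun k z => ?_)
      y hy _ (hμ _ ⟨y, hy⟩ y hy)).trans ?_
    · exact_mod_cast card_filter_blockIdx_le (E n ω) k z
    · rw [hcard]
      push_cast
      exact le_rfl

end

/-! ### The exponents -/

theorem five_ninths_le : (5 / 9 : ℝ) ≤ (Real.logb 2 13 - 2) / 3 := by
  have h : (11 / 3 : ℝ) ≤ Real.logb 2 13 := by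
    rw [Real.le_logb_iff_rpow_le (by norm_num) (by norm_num)]
    refine le_of_pow_le_pow_left₀ (n := 3) (by norm_num) (by norm_num) ?_
    rw [← Real.rpow_natCast, ← Real.rpow_mul (by norm_num)]
    norm_num
  linarith

theorem three_rpow_four_fifths_lt : (3 : ℝ) ^ (4 / 5 : ℝ) < 8 / 3 := by
  refine lt_of_pow_lt_pow_left₀ 5 (by norm_num) ?_
  rw [← Real.rpow_natCast, ← Real.rpow_mul (by norm_num)]
  norm_num

theorem resistance_factor_lt_one {m : ℕ} (hm : 3 ≤ m) :
    9 / (3 ^ m - 3) * ((3 : ℝ) ^ m) ^ (1 - 2 / ((m : ℝ) - 2)) < 1 := by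
  have hm' : (3 : ℝ) ≤ m := by exact_mod_cast hm
  have hm2 : (0 : ℝ) < (m : ℝ) - 2 := by linarith
  set x : ℝ := 4 / ((m : ℝ) - 2) with hx
  have hx0 : 0 < x := by positivity
  have h3 : (0 : ℝ) < 3 ^ m := by positivity
  have hpow : ((3 : ℝ) ^ m) ^ (1 - 2 / ((m : ℝ) - 2)) = 3 ^ m / 9 / (3 : ℝ) ^ x := by
    have h9 : (9 : ℝ) = (3 : ℝ) ^ (2 : ℝ) := by norm_num
    rw [h9, ← Real.rpow_natCast, ← Real.rpow_mul (by norm_num), ← Real.rpow_sub (by norm_num),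
      ← Real.rpow_sub (by norm_num)]
    congr 1
    rw [hx]
    field_simp
    ring
  have hexp : 1 + x ≤ (3 : ℝ) ^ x := by
    have hlog : 1 ≤ Real.log 3 := by
      rw [Real.le_log_iff_exp_le (by norm_num)]
      linarith [Real.exp_one_lt_d9]
    rw [Real.rpow_def_of_pos (by norm_num)]
    calc 1 + x ≤ Real.exp x := by linarith [Real.add_one_le_exp x]
      _ ≤ _ := by
        gcongr
        nlinarith
  have hbern : (m : ℝ) * 3 ≤ 3 ^ m := by
    obtain ⟨k, rfl⟩ : ∃ k, m = k + 1 := ⟨m - 1, by omega⟩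
    have : (k + 1 : ℕ) ≤ 3 ^ k := Nat.lt_pow_self (by norm_num)
    have h' : ((k + 1 : ℕ) : ℝ) ≤ 3 ^ k := by exact_mod_cast this
    rw [pow_succ]
    linarith
  have hden : (0 : ℝ) < 3 ^ m - 3 := by linarith
  have hpos : (0 : ℝ) < 3 ^ x := by positivity
  rw [hpow]
  have hxm : x * ((m : ℝ) - 2) = 4 := by rw [hx]; field_simp
  have hmain : (3 : ℝ) ^ m < (3 ^ m - 3) * (1 + x) := by
    have h1 : (3 * m - 3 : ℝ) * x ≤ (3 ^ m - 3) * x := by gcongr; linarith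
    nlinarith
  calc 9 / (3 ^ m - 3) * (3 ^ m / 9 / (3 : ℝ) ^ x) = 3 ^ m / ((3 ^ m - 3) * 3 ^ x) := by
        field_simp
    _ < 1 := by
        rw [div_lt_one (by positivity)]
        exact hmain.trans_le (by gcongr)

/-- The dimension `d(m)` lies in `(2, m]`. -/
theorem two_lt_dim_and_dim_le {m : ℕ} (hm : 3 ≤ m) :
    2 < Real.log (3 ^ m - 1) / (Real.log (3 ^ m - 1) - Real.log (3 ^ (m - 1) - 1)) ∧
      Real.log (3 ^ m - 1) / (Real.log (3 ^ m - 1) - Real.log (3 ^ (m - 1) - 1)) ≤ m := by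
  obtain ⟨k, rfl⟩ : ∃ k, m = k + 1 := ⟨m - 1, by omega⟩
  rw [Nat.add_sub_cancel]
  set t : ℝ := 3 ^ k with ht
  have ht9 : 9 ≤ t := by
    calc (9 : ℝ) = 3 ^ 2 := by norm_num
      _ ≤ 3 ^ k := pow_le_pow_right₀ (by norm_num) (by omega)
  have ha : (3 : ℝ) ^ (k + 1) - 1 = 3 * t - 1 := by rw [pow_succ]; ring
  rw [ha]
  have hlt : Real.log (t - 1) < Real.log (3 * t - 1) :=
    Real.log_lt_log (by linarith) (by linarith)
  have hpos : 0 < Real.log (3 * t - 1) - Real.log (t - 1) := by linarith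
  constructor
  · rw [lt_div_iff₀ hpos]
    have : Real.log (3 * t - 1) < Real.log ((t - 1) ^ 2) :=
      Real.log_lt_log (by linarith) (by nlinarith)
    rw [Real.log_pow] at this
    push_cast at this
    linarith
  · rw [div_le_iff₀ hpos]
    have : Real.log ((t - 1) ^ (k + 1)) ≤ Real.log ((3 * t - 1) ^ k) := by
      refine Real.log_le_log (pow_pos (by linarith) _) ?_
      calc (t - 1) ^ (k + 1) = (t - 1) ^ k * (t - 1) := pow_succ _ _
        _ ≤ (t - 1) ^ k * t := by
          have : 0 ≤ (t - 1) ^ k := pow_nonneg (by linarith) _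
          gcongr
          linarith
        _ = (3 * (t - 1)) ^ k := by rw [ht, ← mul_pow, mul_comm]
        _ ≤ _ := by
          gcongr <;> linarith
    rw [Real.log_pow, Real.log_pow] at this
    push_cast at this ⊢
    linarith

theorem rpow_neg_mul_le {n β β' K r : ℝ} (hn : 1 ≤ n) (hβ : β' ≤ β)
    (hK : 0 ≤ K) (hr : r ≤ K * n ^ β') : n ^ (-β) * r ≤ K := by
  have hn0 : 0 < n := by linarith
  calc n ^ (-β) * r ≤ n ^ (-β) * (K * n ^ β') := by gcongr
    _ = K * n ^ (β' - β) := by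
      rw [sub_eq_add_neg, Real.rpow_add hn0]
      ring
    _ ≤ K * 1 := by
      gcongr
      exact Real.rpow_le_one_of_one_le_of_nonpos hn (by linarith)
    _ = K := mul_one K

/-- **External DLA on the `m`-dimensional Sierpinski carpet graph, `m ≥ 3`
(Benjamini–Yadin): growth of arms.** -/
theorem external_dla_sierpinski_carpet_arm_growth
    (m : ℕ) (hm : 3 ≤ m)
    (o : CarpetV m) (ho : o.1 = fun _ => 0)
    {Ω : Type*} [MeasurableSpace Ω] (P : Measure Ω) [IsProbabilityMeasure P]
    (E : ℕ → Ω → Finset (CarpetV m)) (Y : ℕ → Ω → CarpetV m)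
    -- the harmonic measure from infinity of a finite set `A`: the limit of the hitting
    -- distribution of the (transient, for `m ≥ 3`) SRW conditioned to hit `A`,
    -- equivalently the normalized equilibrium measure of `A`
    (μh : Finset (CarpetV m) → CarpetV m → ℝ)
    (hμ : ∀ A : Finset (CarpetV m), A.Nonempty → ∀ y ∈ A,
      Tendsto (fun x => hitMeas cNbrs (↑A) x y / ∑ z ∈ A, hitMeas cNbrs (↑A) x z)
        cofinite (𝓝 (μh A y)))
    -- dynamics of the external DLA chain, started from the origin
    (h0 : ∀ ω, E 0 ω = {o})
    (hstep : ∀ n ω, E (n+1) ω = insert (Y (n+1) ω) (E n ω))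
    (hbd : ∀ n ω, Y (n+1) ω ∈ bdryF cNbrs (E n ω))
    (hlaw : ∀ (n : ℕ) (A : Finset (CarpetV m)), ∀ y ∈ bdryF cNbrs A,
      P {ω | E n ω = A ∧ Y (n+1) ω = y}
        = ENNReal.ofReal (μh (bdryF cNbrs A) y) * P {ω | E n ω = A}) :
    -- `m = 3`: a.s. `limsup n^{-β} r(E_n) < ∞` with `β = (log₂ 13 - 2)/3`
    (m = 3 → ∀ᵐ ω ∂P,
      IsBoundedUnder (· ≤ ·) atTop
        (fun n : ℕ => (n : ℝ) ^ (-((Real.logb 2 13 - 2) / 3)) * radC o (E n ω))) ∧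
    -- `m = 4`: a.s. `limsup n^{-1/2} r(E_n) < ∞`
    (m = 4 → ∀ᵐ ω ∂P,
      IsBoundedUnder (· ≤ ·) atTop
        (fun n : ℕ => (n : ℝ) ^ (-(1/2 : ℝ)) * radC o (E n ω))) ∧
    -- `m ≥ 5`: a.s. `limsup (log n)⁻¹ n^{-2/(d(m)-2)} r(E_n) < ∞` with
    -- `d(m) = log(3^m - 1) / (log(3^m - 1) - log(3^{m-1} - 1))`
    (5 ≤ m → ∀ᵐ ω ∂P,
      IsBoundedUnder (· ≤ ·) atTop
        (fun n : ℕ =>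
          (Real.log n)⁻¹ *
            (n : ℝ) ^
              (-(2 / (Real.log (3 ^ m - 1) /
                  (Real.log (3 ^ m - 1) - Real.log (3 ^ (m - 1) - 1)) - 2))) *
            radC o (E n ω))) := by
  refine ⟨fun h3 => ?_, fun h4 => ?_, fun h5 => ?_⟩
  · subst h3
    obtain ⟨K, hK, h⟩ := ae_eventually_radC_le_of_arms hm ho hμ h0 hstep hbd hlaw (γ := 4 / 5)
      (by norm_num) (by norm_num) (by linarith [three_rpow_four_fifths_lt])
    filter_upwards [h] with ω hω
    refine isBoundedUnder_of_eventually_le (a := K) ?_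
    filter_upwards [hω, eventually_ge_atTop 1] with n hn hn1
    refine rpow_neg_mul_le (by exact_mod_cast hn1) ?_ hK hn
    linarith [five_ninths_le]
  · subst h4
    obtain ⟨K, hK, h⟩ := ae_eventually_radC_le_of_arms hm ho hμ h0 hstep hbd hlaw (γ := 1)
      (by norm_num) (by norm_num) (by norm_num)
    filter_upwards [h] with ω hω
    refine isBoundedUnder_of_eventually_le (a := K) ?_
    filter_upwards [hω, eventually_ge_atTop 1] with n hn hn1
    exact rpow_neg_mul_le (by exact_mod_cast hn1) (by norm_num) hK hn
  · have hm5 : (5 : ℝ) ≤ m := by exact_mod_cast h5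
    have hm2 : (0 : ℝ) < m - 2 := by linarith
    obtain ⟨hd2, hdm⟩ := two_lt_dim_and_dim_le hm
    obtain ⟨K, hK, h⟩ := ae_eventually_radC_le_of_card hm ho hμ h0 hstep hbd hlaw
      (γ := 1 - 2 / ((m : ℝ) - 2))
      (sub_nonneg.2 ((div_le_one hm2).2 (by linarith))) (sub_lt_self 1 (by positivity))
      (resistance_factor_lt_one hm)
    filter_upwards [h] with ω hω
    refine isBoundedUnder_of_eventually_le (a := K) ?_
    filter_upwards [hω, eventually_ge_atTop 3] with n hn hn3
    have hn3' : (3 : ℝ) ≤ n := by exact_mod_cast hn3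
    have hlog : 1 ≤ Real.log n := by
      rw [Real.le_log_iff_exp_le (by linarith)]
      linarith [Real.exp_one_lt_d9]
    rw [mul_assoc]
    calc _ ≤ (Real.log n)⁻¹ * K := by
          refine mul_le_mul_of_nonneg_left (rpow_neg_mul_le (by linarith) ?_ hK hn)
            (inv_nonneg.2 (by linarith))
          rw [sub_sub_cancel]
          exact div_le_div_of_nonneg_left (by norm_num) (by linarith) (by linarith)
      _ ≤ K := mul_le_of_le_one_left hK (inv_le_one_of_one_le₀ hlog)
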